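/- Let p ≥ 2, α = p−1 and θ ≥ 0 with k₀ = p−1, and suppose σ_* < μ_{α,θ}. Then for every σ with σ_* < σ < μ_{α,θ} the critical supremum TMC(σ,α,θ) is attained by some u ∈ X with ‖u‖ ≤ 1. -/

import Mathlib

open MeasureTheory Real Filter ENNReal

/-- The fractional-dimension spherical volume constant `ω_θ = 2π^((θ+1)/2)/Γ((θ+1)/2)`. -/
noncomputable def omegaW (θ : ℝ) : ℝ := 2 * Real.pi ^ ((θ + 1) / 2) / Real.Gamma ((θ + 1) / 2)

/-- Weighted integral `∫₀^∞ f dλ_θ = ω_θ ∫₀^∞ f(r) r^θ dr` (for nonnegative integrands,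
valued in `ℝ≥0∞`). -/
noncomputable def wInt (θ : ℝ) (f : ℝ → ℝ) : ℝ≥0∞ :=
  ENNReal.ofReal (omegaW θ) *
    ∫⁻ r in Set.Ioi (0 : ℝ), ENNReal.ofReal (f r) * ENNReal.ofReal (r ^ θ)

/-- The weighted Lebesgue norm `‖u‖_{L^q_θ}` (valued in `ℝ≥0∞`). -/
noncomputable def wNorm (θ q : ℝ) (u : ℝ → ℝ) : ℝ≥0∞ :=
  (wInt θ fun r => |u r| ^ q) ^ (1 / q)

/-- Membership in the weighted Sobolev space `X = X^{1,p}_∞(α,θ)`: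
`u` is locally absolutely continuous on `(0,∞)` with a.e. derivative `u'`
(expressed through the fundamental theorem of calculus on compact subintervals),
`u(r) → 0` as `r → ∞`, `‖u‖_{L^p_θ} < ∞` and `‖u'‖_{L^p_α} < ∞`. -/
structure MemX (p α θ : ℝ) (u u' : ℝ → ℝ) : Prop where
  ftc_int : ∀ a b : ℝ, 0 < a → a ≤ b → IntervalIntegrable u' MeasureTheory.volume a b
  ftc : ∀ a b : ℝ, 0 < a → a ≤ b → u b - u a = ∫ t in a..b, u' t
  lim_zero : Filter.Tendsto u Filter.atTop (nhds 0)
  fin_u : wNorm θ p u < ⊤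
  fin_u' : wNorm α p u' < ⊤

/-- Full norm on `X`: `‖u‖ = (‖u‖_{L^p_θ}^p + ‖u'‖_{L^p_α}^p)^{1/p}`. -/
noncomputable def Xnorm (p α θ : ℝ) (u u' : ℝ → ℝ) : ℝ≥0∞ :=
  ((wNorm θ p u) ^ p + (wNorm α p u') ^ p) ^ (1 / p)

/-- The truncated exponential `φ_p(t) = Σ_{j ∈ ℕ, j ≥ p-1} t^j / j!`. -/
noncomputable def phiP (p t : ℝ) : ℝ :=
  ∑' j : ℕ, if p - 1 ≤ (j : ℝ) then t ^ j / (Nat.factorial j : ℝ) else 0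

/-- The critical constant `μ_{α,θ} = (θ+1) ω_α^{1/α}`. -/
noncomputable def muC (α θ : ℝ) : ℝ := (θ + 1) * (omegaW α) ^ (1 / α)

/-- The Trudinger–Moser functional `∫₀^∞ φ_p(μ |u|^{p/(p-1)}) dλ_θ`. -/
noncomputable def TMfunc (p θ μ : ℝ) (u : ℝ → ℝ) : ℝ≥0∞ :=
  wInt θ fun r => phiP p (μ * |u r| ^ (p / (p - 1)))

/-- The subcritical Trudinger–Moser supremum
`TMSC(μ,α,θ) = sup { ‖u‖_{L^p_θ}^{-p} ∫₀^∞ φ_p(μ|u|^{p/(p-1)}) dλ_θ : u ∈ X, u ≠ 0, ‖u'‖_{L^p_α} ≤ 1 }`. -/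
noncomputable def TMSC (p α θ μ : ℝ) : ℝ≥0∞ :=
  ⨆ (u : ℝ → ℝ) (u' : ℝ → ℝ) (_ : MemX p α θ u u') (_ : u ≠ 0)
    (_ : wNorm α p u' ≤ 1), (wNorm θ p u) ^ (-p) * TMfunc p θ μ u

/-- The critical Trudinger–Moser supremum
`TMC(σ,α,θ) = sup { ∫₀^∞ φ_p(σ|u|^{p/(p-1)}) dλ_θ : u ∈ X, ‖u‖ ≤ 1 }`. -/
noncomputable def TMC (p α θ σ : ℝ) : ℝ≥0∞ :=
  ⨆ (u : ℝ → ℝ) (u' : ℝ → ℝ) (_ : MemX p α θ u u') (_ : Xnorm p α θ u u' ≤ 1),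
    TMfunc p θ σ u

/-- `k₀ = min { j ∈ ℕ : j ≥ p - 1 }`. -/
noncomputable def k0 (p : ℝ) : ℕ := sInf {j : ℕ | p - 1 ≤ (j : ℝ)}

/-- `TMC(σ,α,θ)` is attained by some `u ∈ X` with `‖u‖ ≤ 1`. -/
def TMCAttained (p α θ σ : ℝ) : Prop :=
  ∃ u u' : ℝ → ℝ, MemX p α θ u u' ∧ Xnorm p α θ u u' ≤ 1 ∧
    TMC p α θ σ = TMfunc p θ σ u

/-- `σ_* = inf { σ ∈ (0, μ_{α,θ}) : TMC(σ,α,θ) is attained }`. -/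
noncomputable def sigmaStar (p α θ : ℝ) : ℝ :=
  sInf {σ : ℝ | σ ∈ Set.Ioo 0 (muC α θ) ∧ TMCAttained p α θ σ}

section

open Set Topology

/-- The measure `λ_θ` on `(0,∞)` with density `ω_θ r^θ`. -/
noncomputable def wMeas (θ : ℝ) : Measure ℝ :=
  ENNReal.ofReal (omegaW θ) •
    (volume.restrict (Ioi (0 : ℝ))).withDensity fun r => ENNReal.ofReal (r ^ θ)

theorem lintegral_wMeas (θ : ℝ) (f : ℝ → ℝ≥0∞) :
    ∫⁻ r, f r ∂wMeas θ =
      ENNReal.ofReal (omegaW θ) * ∫⁻ r in Ioi (0 : ℝ), f r * ENNReal.ofReal (r ^ θ) := by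
  rw [wMeas, lintegral_smul_measure, lintegral_withDensity_eq_lintegral_mul_non_measurable]
  · simp [mul_comm]
  · fun_prop
  · simp

theorem wInt_eq_lintegral (θ : ℝ) (f : ℝ → ℝ) :
    wInt θ f = ∫⁻ r, ENNReal.ofReal (f r) ∂wMeas θ := by
  rw [lintegral_wMeas, wInt]

theorem omegaW_pos {θ : ℝ} (hθ : 0 ≤ θ) : 0 < omegaW θ := by
  have := Real.Gamma_pos_of_pos (s := (θ + 1) / 2) (by linarith)
  unfold omegaW
  positivity

theorem wMeas_absolutelyContinuous (θ : ℝ) : wMeas θ ≪ volume.restrict (Ioi (0 : ℝ)) :=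
  (Measure.smul_absolutelyContinuous).trans (withDensity_absolutelyContinuous _ _)

theorem ae_wMeas_of_forall_pos {θ : ℝ} {P : ℝ → Prop} (h : ∀ r, 0 < r → P r) :
    ∀ᵐ r ∂wMeas θ, P r :=
  (wMeas_absolutelyContinuous θ).ae_le ((ae_restrict_iff' measurableSet_Ioi).2
    (Eventually.of_forall h))

theorem wNorm_rpow {θ q : ℝ} (hq : 0 < q) (u : ℝ → ℝ) :
    wNorm θ q u ^ q = wInt θ fun r => |u r| ^ q := by
  rw [wNorm, ← ENNReal.rpow_mul, one_div_mul_cancel hq.ne', ENNReal.rpow_one]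

theorem wNorm_lt_top_iff {θ q : ℝ} (hq : 0 < q) (u : ℝ → ℝ) :
    wNorm θ q u < ⊤ ↔ (wInt θ fun r => |u r| ^ q) < ⊤ := by
  rw [wNorm, ENNReal.rpow_lt_top_iff_of_pos (by positivity)]

theorem Xnorm_le_one_iff {p α θ : ℝ} (hp : 0 < p) (u u' : ℝ → ℝ) :
    Xnorm p α θ u u' ≤ 1 ↔
      (wInt θ fun r => |u r| ^ p) + (wInt α fun r => |u' r| ^ p) ≤ 1 := by
  rw [Xnorm, wNorm_rpow hp, wNorm_rpow hp]
  conv_lhs => rw [← ENNReal.one_rpow (1 / p)]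
  rw [ENNReal.rpow_le_rpow_iff (by positivity)]

theorem MemX.aemeasurable_deriv {p α θ : ℝ} {u u' : ℝ → ℝ} (h : MemX p α θ u u') :
    AEMeasurable u' (volume.restrict (Ioi (0 : ℝ))) := by
  have hU : Ioi (0 : ℝ) = ⋃ n : ℕ, Ioc ((n + 1 : ℝ)⁻¹) (n + 1 : ℝ) := by
    ext x
    simp only [mem_Ioi, mem_iUnion, mem_Ioc]
    constructor
    · intro hx
      obtain ⟨n, hn⟩ := exists_nat_gt (max x x⁻¹)
      refine ⟨n, ?_, ?_⟩
      · rw [inv_lt_comm₀ (by positivity) hx]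
        have := le_max_right x x⁻¹
        linarith
      · have := le_max_left x x⁻¹
        linarith
    · rintro ⟨n, h1, -⟩
      exact lt_trans (by positivity) h1
  rw [hU, aemeasurable_iUnion_iff]
  intro n
  have h1 : (n + 1 : ℝ)⁻¹ ≤ n + 1 := by
    have : (1 : ℝ) ≤ n + 1 := by linarith [n.cast_nonneg (α := ℝ)]
    exact (inv_le_one_of_one_le₀ this).trans this
  have := h.ftc_int (n + 1 : ℝ)⁻¹ (n + 1) (by positivity) h1
  rw [intervalIntegrable_iff_integrableOn_Ioc_of_le h1] at this
  exact this.aestronglyMeasurable.aemeasurable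

theorem MemX.continuousOn {p α θ : ℝ} {u u' : ℝ → ℝ} (h : MemX p α θ u u') :
    ContinuousOn u (Ioi (0 : ℝ)) := by
  intro x hx
  have hx : 0 < x := hx
  have h2 : IntervalIntegrable u' volume (x / 2) (2 * x) :=
    h.ftc_int _ _ (by linarith) (by linarith)
  have hc := intervalIntegral.continuousOn_primitive_interval' h2 (a := x / 2) (by simp)
  rw [uIcc_of_le (by linarith)] at hc
  have h3 : ContinuousAt (fun y => u (x / 2) + ∫ t in (x / 2)..y, u' t) x :=
    continuousAt_const.add (hc.continuousAt (Icc_mem_nhds (by linarith) (by linarith)))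
  refine ContinuousAt.continuousWithinAt (h3.congr ?_)
  filter_upwards [Icc_mem_nhds (show x / 2 < x by linarith) (show x < 2 * x by linarith)] with y hy
  rw [← h.ftc _ _ (by linarith) hy.1]
  ring

theorem MemX.aemeasurable {p α θ : ℝ} {u u' : ℝ → ℝ} (h : MemX p α θ u u') :
    AEMeasurable u (volume.restrict (Ioi (0 : ℝ))) :=
  h.continuousOn.aemeasurable measurableSet_Ioi

/-- The exponential with its Taylor polynomial of degree `k` removed. -/
noncomputable def expTail (k : ℕ) (t : ℝ) : ℝ :=
  Real.exp t - ∑ j ∈ Finset.range (k + 1), t ^ j / (Nat.factorial j : ℝ)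

theorem continuous_expTail (k : ℕ) : Continuous (expTail k) := by
  unfold expTail
  fun_prop

theorem hasSum_expTail (k : ℕ) (t : ℝ) :
    HasSum (fun j : ℕ => t ^ (j + (k + 1)) / (Nat.factorial (j + (k + 1)) : ℝ)) (expTail k t) := by
  rw [expTail, hasSum_nat_add_iff (f := fun j : ℕ => t ^ j / (Nat.factorial j : ℝ)) (k + 1)]
  rw [sub_add_cancel, Real.exp_eq_exp_ℝ]
  exact NormedSpace.expSeries_div_hasSum_exp t

theorem expTail_nonneg (k : ℕ) {t : ℝ} (ht : 0 ≤ t) : 0 ≤ expTail k t :=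
  (hasSum_expTail k t).nonneg fun j => by positivity

theorem expTail_pos (k : ℕ) {t : ℝ} (ht : 0 < t) : 0 < expTail k t := by
  have h := hasSum_expTail k t
  rw [← h.tsum_eq]
  exact h.summable.tsum_pos (fun j => by positivity) 0 (by positivity)

theorem expTail_le_exp (k : ℕ) {t : ℝ} (ht : 0 ≤ t) : expTail k t ≤ Real.exp t := by
  rw [expTail]
  have : 0 ≤ ∑ j ∈ Finset.range (k + 1), t ^ j / (Nat.factorial j : ℝ) :=
    Finset.sum_nonneg fun j _ => by positivity
  linarith

theorem expTail_le (k : ℕ) {t : ℝ} (ht : 0 ≤ t) : expTail k t ≤ t ^ (k + 1) * Real.exp t := by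
  have h2 : HasSum (fun j : ℕ => t ^ j / (Nat.factorial j : ℝ)) (Real.exp t) := by
    rw [Real.exp_eq_exp_ℝ]
    exact NormedSpace.expSeries_div_hasSum_exp t
  refine hasSum_le (fun j => ?_) (hasSum_expTail k t) (h2.mul_left (t ^ (k + 1)))
  rw [pow_add, mul_comm (t ^ j), mul_div_assoc]
  have : (Nat.factorial j : ℝ) ≤ (Nat.factorial (j + (k + 1)) : ℝ) := by
    exact_mod_cast Nat.factorial_le (by omega)
  gcongr

theorem expTail_mul_ge (k : ℕ) {c t : ℝ} (hc : 1 ≤ c) (ht : 0 ≤ t) :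
    c ^ (k + 1) * expTail k t ≤ expTail k (c * t) := by
  refine hasSum_le (fun j => ?_) ((hasSum_expTail k t).mul_left (c ^ (k + 1)))
    (hasSum_expTail k (c * t))
  rw [mul_pow, mul_div_assoc]
  have : c ^ (k + 1) ≤ c ^ (j + (k + 1)) := pow_le_pow_right₀ hc (by omega)
  gcongr

theorem phiP_eq {p : ℝ} {k : ℕ} (hk : (k : ℝ) = p - 1) (t : ℝ) :
    phiP p t = t ^ k / (Nat.factorial k : ℝ) + expTail k t := by
  have h1 : HasSum (fun j : ℕ => if p - 1 ≤ (j : ℝ) then t ^ j / (Nat.factorial j : ℝ) else 0)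
      (t ^ k / (Nat.factorial k : ℝ) + expTail k t) := by
    rw [← hasSum_nat_add_iff' (k + 1)]
    have h0 : ∑ i ∈ Finset.range (k + 1),
        (if p - 1 ≤ (i : ℝ) then t ^ i / (Nat.factorial i : ℝ) else 0)
        = t ^ k / (Nat.factorial k : ℝ) := by
      rw [Finset.sum_range_succ, Finset.sum_eq_zero]
      · simp [← hk]
      · intro i hi
        rw [if_neg]
        rw [← hk, not_le]
        exact_mod_cast Finset.mem_range.1 hi
    rw [h0, add_sub_cancel_left]
    refine (hasSum_expTail k t).congr_fun ?_
    intro j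
    rw [if_pos]
    rw [← hk]
    push_cast
    linarith [j.cast_nonneg (α := ℝ)]
  exact h1.tsum_eq

theorem TMfunc_eq {p θ σ : ℝ} {k : ℕ} (hk : (k : ℝ) = p - 1) (hp : 2 ≤ p) (hσ : 0 ≤ σ)
    {u : ℝ → ℝ} (hu : AEMeasurable u (volume.restrict (Ioi (0 : ℝ)))) :
    TMfunc p θ σ u = ENNReal.ofReal (σ ^ k / (Nat.factorial k : ℝ)) * (wInt θ fun r => |u r| ^ p) +
      ∫⁻ r, ENNReal.ofReal (expTail k (σ * |u r| ^ (p / (p - 1)))) ∂wMeas θ := by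
  have hu' := hu.mono_ac (wMeas_absolutelyContinuous θ)
  rw [TMfunc, wInt_eq_lintegral, wInt_eq_lintegral, ← lintegral_const_mul'' _ (by fun_prop),
    ← lintegral_add_left' (by fun_prop)]
  refine lintegral_congr fun r => ?_
  rw [phiP_eq hk, ← ENNReal.ofReal_mul (by positivity),
    ENNReal.ofReal_add (by positivity) (expTail_nonneg _ (by positivity))]
  congr 2
  rw [mul_pow, ← Real.rpow_mul_natCast (abs_nonneg _), hk, div_mul_cancel₀ _ (by linarith)]
  ring

/-- Weighted Hölder inequality against the scale-invariant measure `dr / r`. -/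
theorem setLIntegral_abs_le {p : ℝ} (hp : 2 ≤ p) {v : ℝ → ℝ}
    (hv : AEMeasurable v (volume.restrict (Ioi (0 : ℝ))))
    (hv1 : (wInt (p - 1) fun r => |v r| ^ p) ≤ 1) {E : Set ℝ} (hE : MeasurableSet E)
    (hE0 : E ⊆ Ioi 0) :
    ∫⁻ r in E, ENNReal.ofReal |v r| ≤ ENNReal.ofReal (omegaW (p - 1) ^ (-(1 / p))) *
      (∫⁻ r in E, ENNReal.ofReal r⁻¹) ^ ((p - 1) / p) := by
  have hpq : p.HolderConjugate (p / (p - 1)) := Real.HolderConjugate.conjExponent (by linarith)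
  have hω : 0 < omegaW (p - 1) := omegaW_pos (by linarith)
  have hvE : AEMeasurable v (volume.restrict E) := hv.mono_measure (Measure.restrict_mono hE0 le_rfl)
  set F : ℝ → ℝ≥0∞ := fun r => ENNReal.ofReal (|v r| * r ^ ((p - 1) / p)) with hF
  set G : ℝ → ℝ≥0∞ := fun r => ENNReal.ofReal (r ^ (-((p - 1) / p))) with hG
  have hpos : ∀ r ∈ E, (0 : ℝ) < r := fun r hr => hE0 hr
  have hFG : ∫⁻ r in E, ENNReal.ofReal |v r| = ∫⁻ r in E, (F * G) r := by
    refine setLIntegral_congr_fun hE fun r hr => ?_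
    have h0 := hpos r hr
    simp only [hF, hG, Pi.mul_apply]
    rw [← ENNReal.ofReal_mul (by positivity), mul_assoc, ← Real.rpow_add h0, add_neg_cancel,
      Real.rpow_zero, mul_one]
  have hFp : ∫⁻ r in E, F r ^ p ≤ ENNReal.ofReal (omegaW (p - 1) ^ (-1 : ℝ)) := by
    have h1 : ∫⁻ r in E, F r ^ p
        = ∫⁻ r in E, ENNReal.ofReal (|v r| ^ p) * ENNReal.ofReal (r ^ (p - 1)) := by
      refine setLIntegral_congr_fun hE fun r hr => ?_
      have h0 := hpos r hr
      simp only [hF]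
      rw [ENNReal.ofReal_rpow_of_nonneg (by positivity) (by linarith),
        Real.mul_rpow (by positivity) (by positivity), ← Real.rpow_mul h0.le,
        div_mul_cancel₀ _ (by linarith), ENNReal.ofReal_mul (by positivity)]
    rw [h1]
    have h2 : ENNReal.ofReal (omegaW (p - 1)) *
        ∫⁻ r in E, ENNReal.ofReal (|v r| ^ p) * ENNReal.ofReal (r ^ (p - 1)) ≤ 1 :=
      le_trans (mul_le_mul_right (lintegral_mono_set hE0) _) hv1
    rw [Real.rpow_neg_one, ENNReal.ofReal_inv_of_pos hω, ENNReal.le_inv_iff_mul_le, mul_comm]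
    exact h2
  have hGq : ∫⁻ r in E, G r ^ (p / (p - 1)) = ∫⁻ r in E, ENNReal.ofReal r⁻¹ := by
    refine setLIntegral_congr_fun hE fun r hr => ?_
    have h0 := hpos r hr
    have hp1 : p - 1 ≠ 0 := by linarith
    simp only [hG]
    rw [ENNReal.ofReal_rpow_of_pos (by positivity), ← Real.rpow_mul h0.le]
    have : -((p - 1) / p) * (p / (p - 1)) = -1 := by field_simp
    rw [this, Real.rpow_neg_one]
  rw [hFG]
  refine (ENNReal.lintegral_mul_le_Lp_mul_Lq _ hpq (by fun_prop) (by fun_prop)).trans ?_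
  rw [hGq, one_div_div]
  gcongr
  calc (∫⁻ r in E, F r ^ p) ^ (1 / p)
      ≤ (ENNReal.ofReal (omegaW (p - 1) ^ (-1 : ℝ))) ^ (1 / p) := by gcongr
    _ = _ := by
      rw [ENNReal.ofReal_rpow_of_pos (by positivity), ← Real.rpow_mul hω.le]
      congr 2
      ring

theorem setLIntegral_inv_Ioc {a b : ℝ} (ha : 0 < a) (hab : a ≤ b) :
    ∫⁻ r in Ioc a b, ENNReal.ofReal r⁻¹ = ENNReal.ofReal (Real.log (b / a)) := by
  rw [← ofReal_integral_eq_lintegral_ofReal, ← intervalIntegral.integral_of_le hab,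
    integral_inv_of_pos ha (ha.trans_le hab)]
  · have : IntervalIntegrable (fun r : ℝ => r⁻¹) volume a b :=
      intervalIntegral.intervalIntegrable_inv
        (fun x hx => by rw [uIcc_of_le hab] at hx; linarith [hx.1]) continuousOn_id
    rwa [intervalIntegrable_iff_integrableOn_Ioc_of_le hab] at this
  · filter_upwards [ae_restrict_mem measurableSet_Ioc] with r hr
    have : 0 < r := ha.trans hr.1
    simp only [Pi.zero_apply]
    positivity

theorem MemX.abs_sub_le_lintegral {p α θ : ℝ} {u u' : ℝ → ℝ} (h : MemX p α θ u u') {a b : ℝ}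
    (ha : 0 < a) (hab : a ≤ b) :
    ENNReal.ofReal |u b - u a| ≤ ∫⁻ r in Ioc a b, ENNReal.ofReal |u' r| := by
  rw [h.ftc a b ha hab, intervalIntegral.integral_of_le hab]
  have := enorm_integral_le_lintegral_enorm (μ := volume.restrict (Ioc a b)) u'
  simpa only [Real.enorm_eq_ofReal_abs] using this

/-- Logarithmic modulus of continuity of functions in the unit ball of `X`. -/
theorem MemX.abs_sub_le {p θ : ℝ} (hp : 2 ≤ p) {u u' : ℝ → ℝ} (h : MemX p (p - 1) θ u u')
    (h1 : (wInt (p - 1) fun r => |u' r| ^ p) ≤ 1) {a b : ℝ} (ha : 0 < a) (hab : a ≤ b) :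
    |u b - u a| ≤ omegaW (p - 1) ^ (-(1 / p)) * Real.log (b / a) ^ ((p - 1) / p) := by
  have hω : 0 < omegaW (p - 1) := omegaW_pos (by linarith)
  have hlog : 0 ≤ Real.log (b / a) := Real.log_nonneg ((one_le_div ha).2 hab)
  have h2 := (h.abs_sub_le_lintegral ha hab).trans (setLIntegral_abs_le hp h.aemeasurable_deriv h1
    measurableSet_Ioc (fun r hr => ha.trans hr.1))
  rw [setLIntegral_inv_Ioc ha hab, ENNReal.ofReal_rpow_of_nonneg hlog
    (div_nonneg (by linarith) (by linarith)), ← ENNReal.ofReal_mul (by positivity)] at h2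
  exact (ENNReal.ofReal_le_ofReal_iff (by positivity)).1 h2

/-- Functions in the unit ball of `X` are uniformly small at infinity. -/
theorem exists_forall_abs_le {p θ : ℝ} (hp : 2 ≤ p) (hθ : 0 ≤ θ) {η : ℝ} (hη : 0 < η) :
    ∃ R : ℝ, 1 ≤ R ∧ ∀ u u' : ℝ → ℝ, MemX p (p - 1) θ u u' →
      (wInt θ fun r => |u r| ^ p) ≤ 1 → (wInt (p - 1) fun r => |u' r| ^ p) ≤ 1 →
      ∀ r, R ≤ r → |u r| ≤ η := by
  have hω : 0 < omegaW (p - 1) := omegaW_pos (by linarith)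
  have hωθ : 0 < omegaW θ := omegaW_pos hθ
  have hC : Tendsto (fun b : ℝ => omegaW (p - 1) ^ (-(1 / p)) * Real.log b ^ ((p - 1) / p))
      (𝓝[>] 1) (𝓝 0) := by
    have h0 : 0 < (p - 1) / p := div_pos (by linarith) (by linarith)
    have : ContinuousAt (fun b : ℝ => omegaW (p - 1) ^ (-(1 / p)) * Real.log b ^ ((p - 1) / p)) 1 :=
      continuousAt_const.mul ((Real.continuousAt_log one_ne_zero).rpow_const (Or.inr h0.le))
    have h2 := this.tendsto
    simp only [Real.log_one, Real.zero_rpow h0.ne', mul_zero] at h2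
    exact h2.mono_left nhdsWithin_le_nhds
  obtain ⟨b, hb, hb1⟩ := ((hC.eventually (gt_mem_nhds (half_pos hη))).and
    self_mem_nhdsWithin).exists
  have hb1 : 1 < b := hb1
  set c := omegaW θ * ((η / 2) ^ p * (b - 1)) with hc
  have hcpos : 0 < c := by have : 0 < b - 1 := by linarith
                           positivity
  refine ⟨max 1 (2 / c), le_max_left _ _, fun u u' hu h1 h2 r hr => ?_⟩
  have hr1 : 1 ≤ r := (le_max_left _ _).trans hr
  have hr2 : 2 / c ≤ r := (le_max_right _ _).trans hr
  by_contra! hcon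
  have key : ∀ s ∈ Ioc r (b * r), ENNReal.ofReal ((η / 2) ^ p) ≤
      ENNReal.ofReal (|u s| ^ p) * ENNReal.ofReal (s ^ θ) := by
    intro s hs
    have h3 := hu.abs_sub_le hp h2 (by linarith) hs.1.le
    have h4 : Real.log (s / r) ≤ Real.log b :=
      Real.log_le_log (div_pos (by linarith [hs.1]) (by linarith))
        ((div_le_iff₀ (by linarith)).2 hs.2)
    have h5 : 0 ≤ Real.log (s / r) :=
      Real.log_nonneg ((one_le_div (by linarith)).2 hs.1.le)
    have h6 : |u s - u r| ≤ η / 2 := h3.trans ((mul_le_mul_of_nonneg_left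
      (Real.rpow_le_rpow h5 h4 (div_nonneg (by linarith) (by linarith))) (by positivity)).trans hb.le)
    have h7 : η / 2 ≤ |u s| := by
      have := abs_sub_abs_le_abs_sub (u r) (u s)
      rw [abs_sub_comm] at this
      linarith
    rw [← ENNReal.ofReal_mul (by positivity)]
    apply ENNReal.ofReal_le_ofReal
    have h8 : 1 ≤ s ^ θ := Real.one_le_rpow (by linarith [hs.1]) hθ
    calc (η / 2) ^ p ≤ |u s| ^ p := Real.rpow_le_rpow (by positivity) h7 (by linarith)
      _ ≤ |u s| ^ p * s ^ θ := le_mul_of_one_le_right (by positivity) h8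
  have h9 : ENNReal.ofReal (c * r) ≤ wInt θ fun r => |u r| ^ p := by
    calc ENNReal.ofReal (c * r) = ENNReal.ofReal (omegaW θ) *
          ∫⁻ s in Ioc r (b * r), ENNReal.ofReal ((η / 2) ^ p) := by
          rw [setLIntegral_const, Real.volume_Ioc, ← ENNReal.ofReal_mul (by positivity),
            ← ENNReal.ofReal_mul (by positivity)]
          congr 1
          rw [hc]; ring
      _ ≤ ENNReal.ofReal (omegaW θ) *
          ∫⁻ s in Ioc r (b * r), ENNReal.ofReal (|u s| ^ p) * ENNReal.ofReal (s ^ θ) := by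
          gcongr 1
          exact setLIntegral_mono' measurableSet_Ioc key
      _ ≤ _ := by
          rw [wInt]
          gcongr 1
          exact lintegral_mono_set fun s hs => lt_trans (by linarith) hs.1
  have h10 := h9.trans h1
  rw [ENNReal.ofReal_le_one] at h10
  have : 2 ≤ c * r := by
    rw [div_le_iff₀ hcpos] at hr2
    linarith
  linarith

theorem MemX.abs_sub_le_abs_log {p θ : ℝ} (hp : 2 ≤ p) {u u' : ℝ → ℝ} (h : MemX p (p - 1) θ u u')
    (h1 : (wInt (p - 1) fun r => |u' r| ^ p) ≤ 1) {a b : ℝ} (ha : 0 < a) (hb : 0 < b) :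
    |u b - u a| ≤ omegaW (p - 1) ^ (-(1 / p)) * |Real.log (b / a)| ^ ((p - 1) / p) := by
  rcases le_total a b with hab | hab
  · rw [abs_of_nonneg (Real.log_nonneg ((one_le_div ha).2 hab))]
    exact h.abs_sub_le hp h1 ha hab
  · rw [← abs_neg (Real.log _), ← Real.log_inv, inv_div,
      abs_of_nonneg (Real.log_nonneg ((one_le_div hb).2 hab)), abs_sub_comm]
    exact h.abs_sub_le hp h1 hb hab

/-- A pointwise bounded, equicontinuous sequence on `(0,∞)` has a pointwise convergent
subsequence. -/
theorem exists_subseq_tendsto {f : ℕ → ℝ → ℝ} {B : ℝ → ℝ}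
    (hB : ∀ n r, 0 < r → |f n r| ≤ B r)
    (hE : ∀ r, 0 < r → ∀ ε > 0, ∃ δ > 0, ∀ s, 0 < s → |s - r| < δ → ∀ n, |f n s - f n r| ≤ ε) :
    ∃ (g : ℝ → ℝ) (φ : ℕ → ℕ), StrictMono φ ∧
      ∀ r, 0 < r → Tendsto (fun n => f (φ n) r) atTop (𝓝 (g r)) := by
  set K : Set ({q : ℚ // 0 < q} → ℝ) :=
    Set.pi univ fun q => Icc (-B (q.1 : ℝ)) (B (q.1 : ℝ)) with hK
  have hKc : IsCompact K := isCompact_univ_pi fun _ => isCompact_Icc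
  have hmem : ∀ n, (fun q : {q : ℚ // 0 < q} => f n (q.1 : ℝ)) ∈ K := fun n q _ =>
    abs_le.1 (hB n _ (by exact_mod_cast q.2))
  obtain ⟨a, -, φ, hφ, ha⟩ := hKc.tendsto_subseq hmem
  rw [tendsto_pi_nhds] at ha
  have hlim : ∀ r, 0 < r → ∃ y, Tendsto (fun n => f (φ n) r) atTop (𝓝 y) := by
    intro r hr
    apply cauchySeq_tendsto_of_complete
    rw [Metric.cauchySeq_iff']
    intro ε hε
    obtain ⟨δ, hδ, hδ'⟩ := hE r hr (ε / 4) (by positivity)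
    obtain ⟨q, hq1, hq2⟩ := exists_rat_btwn (show r < r + δ by linarith)
    have hq0 : 0 < q := by exact_mod_cast hr.trans hq1
    have hc := (ha ⟨q, hq0⟩).cauchySeq
    rw [Metric.cauchySeq_iff'] at hc
    obtain ⟨N, hN⟩ := hc (ε / 4) (by positivity)
    refine ⟨N, fun n hn => ?_⟩
    have h1 := hN n hn
    have h2 := hδ' q (hr.trans hq1) (by rw [abs_of_pos] <;> linarith) (φ n)
    have h3 := hδ' q (hr.trans hq1) (by rw [abs_of_pos] <;> linarith) (φ N)
    simp only [Function.comp_apply, Real.dist_eq] at h1 ⊢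
    rw [abs_lt] at h1 ⊢
    rw [abs_le] at h2 h3
    constructor <;> linarith [h1.1, h1.2, h2.1, h2.2, h3.1, h3.2]
  choose! g hg using hlim
  exact ⟨g, φ, hφ, hg⟩

theorem MemX.sum_dist_le {p θ : ℝ} (hp : 2 ≤ p) {u u' : ℝ → ℝ} (h : MemX p (p - 1) θ u u')
    (h1 : (wInt (p - 1) fun r => |u' r| ^ p) ≤ 1) {a b : ℝ} (ha : 0 < a) (hab : a ≤ b)
    {E : ℕ × (ℕ → ℝ × ℝ)} (hE : E ∈ AbsolutelyContinuousOnInterval.disjWithin a b) :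
    ∑ i ∈ Finset.range E.1, dist (u (E.2 i).1) (u (E.2 i).2) ≤ omegaW (p - 1) ^ (-(1 / p)) *
      (a⁻¹ * ∑ i ∈ Finset.range E.1, dist (E.2 i).1 (E.2 i).2) ^ ((p - 1) / p) := by
  have hω : 0 < omegaW (p - 1) := omegaW_pos (by linarith)
  have he : 0 ≤ (p - 1) / p := div_nonneg (by linarith) (by linarith)
  set U : Set ℝ := ⋃ i ∈ Finset.range E.1, uIoc (E.2 i).1 (E.2 i).2 with hU
  have hUsub : U ⊆ Ioc a b := by
    have := AbsolutelyContinuousOnInterval.biUnion_uIoc_subset_of_mem_disjWithin (n := E.1)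
      (I := E.2) hE
    rwa [uIoc_of_le hab] at this
  have hUm : MeasurableSet U := Finset.measurableSet_biUnion _ fun i _ => measurableSet_uIoc
  have hterm : ∀ i ∈ Finset.range E.1, ENNReal.ofReal (dist (u (E.2 i).1) (u (E.2 i).2)) ≤
      ∫⁻ r in uIoc (E.2 i).1 (E.2 i).2, ENNReal.ofReal |u' r| := by
    intro i hi
    have hi' := hE.1 i hi
    rw [uIcc_of_le hab] at hi'
    rcases le_total (E.2 i).1 (E.2 i).2 with hle | hle
    · rw [uIoc_of_le hle, dist_comm, Real.dist_eq]
      exact h.abs_sub_le_lintegral (ha.trans_le hi'.1.1) hle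
    · rw [uIoc_of_ge hle, Real.dist_eq]
      exact h.abs_sub_le_lintegral (ha.trans_le hi'.2.1) hle
  have hvol : volume U ≤ ENNReal.ofReal (∑ i ∈ Finset.range E.1, dist (E.2 i).1 (E.2 i).2) := by
    rw [ENNReal.ofReal_sum_of_nonneg fun _ _ => dist_nonneg]
    refine (measure_biUnion_finset_le _ _).trans (Finset.sum_le_sum fun i _ => ?_)
    simp [uIoc, Real.dist_eq, max_sub_min_eq_abs']
  have hinv : ∫⁻ r in U, ENNReal.ofReal r⁻¹ ≤
      ENNReal.ofReal (a⁻¹ * ∑ i ∈ Finset.range E.1, dist (E.2 i).1 (E.2 i).2) := by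
    calc ∫⁻ r in U, ENNReal.ofReal r⁻¹ ≤ ∫⁻ r in U, ENNReal.ofReal a⁻¹ := by
          refine setLIntegral_mono' hUm fun r hr => ENNReal.ofReal_le_ofReal ?_
          exact inv_anti₀ ha (hUsub hr).1.le
      _ = ENNReal.ofReal a⁻¹ * volume U := setLIntegral_const _ _
      _ ≤ _ := by
          rw [ENNReal.ofReal_mul (by positivity)]
          gcongr
  have hmain : ENNReal.ofReal (∑ i ∈ Finset.range E.1, dist (u (E.2 i).1) (u (E.2 i).2)) ≤
      ENNReal.ofReal (omegaW (p - 1) ^ (-(1 / p)) *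
      (a⁻¹ * ∑ i ∈ Finset.range E.1, dist (E.2 i).1 (E.2 i).2) ^ ((p - 1) / p)) := by
    have hs : 0 ≤ ∑ i ∈ Finset.range E.1, dist (E.2 i).1 (E.2 i).2 :=
      Finset.sum_nonneg fun _ _ => dist_nonneg
    rw [ENNReal.ofReal_sum_of_nonneg fun _ _ => dist_nonneg, ENNReal.ofReal_mul (by positivity),
      ← ENNReal.ofReal_rpow_of_nonneg (by positivity) he]
    calc _ ≤ ∑ i ∈ Finset.range E.1, ∫⁻ r in uIoc (E.2 i).1 (E.2 i).2, ENNReal.ofReal |u' r| :=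
          Finset.sum_le_sum hterm
      _ = ∫⁻ r in U, ENNReal.ofReal |u' r| :=
          (lintegral_biUnion_finset hE.2 (fun _ _ => measurableSet_uIoc) _).symm
      _ ≤ _ := setLIntegral_abs_le hp h.aemeasurable_deriv h1 hUm
          (fun r hr => ha.trans (hUsub hr).1)
      _ ≤ _ := by gcongr
  refine (ENNReal.ofReal_le_ofReal_iff ?_).1 hmain
  have hs : 0 ≤ ∑ i ∈ Finset.range E.1, dist (E.2 i).1 (E.2 i).2 :=
    Finset.sum_nonneg fun _ _ => dist_nonneg
  positivity

theorem absolutelyContinuousOnInterval_of_tendsto {p θ : ℝ} (hp : 2 ≤ p) {f f' : ℕ → ℝ → ℝ}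
    {g : ℝ → ℝ} (h : ∀ n, MemX p (p - 1) θ (f n) (f' n))
    (h1 : ∀ n, (wInt (p - 1) fun r => |f' n r| ^ p) ≤ 1)
    (hg : ∀ r, 0 < r → Tendsto (fun n => f n r) atTop (𝓝 (g r))) {a b : ℝ} (ha : 0 < a)
    (hab : a ≤ b) : AbsolutelyContinuousOnInterval g a b := by
  rw [absolutelyContinuousOnInterval_iff]
  intro ε hε
  have hC : Tendsto (fun s : ℝ => omegaW (p - 1) ^ (-(1 / p)) * (a⁻¹ * s) ^ ((p - 1) / p))
      (𝓝 0) (𝓝 0) := by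
    have h0 : 0 < (p - 1) / p := div_pos (by linarith) (by linarith)
    have : Continuous (fun s : ℝ => omegaW (p - 1) ^ (-(1 / p)) * (a⁻¹ * s) ^ ((p - 1) / p)) := by
      have := h0.le
      fun_prop (disch := assumption)
    have h2 := this.tendsto 0
    simpa only [mul_zero, Real.zero_rpow h0.ne'] using h2
  obtain ⟨δ, hδ, hδ'⟩ := Metric.eventually_nhds_iff.1 (hC.eventually (gt_mem_nhds hε))
  refine ⟨δ, hδ, fun E hE hs => ?_⟩
  have hs0 : 0 ≤ ∑ i ∈ Finset.range E.1, dist (E.2 i).1 (E.2 i).2 :=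
    Finset.sum_nonneg fun _ _ => dist_nonneg
  refine lt_of_le_of_lt ?_ (hδ' (y := ∑ i ∈ Finset.range E.1, dist (E.2 i).1 (E.2 i).2)
    (by rwa [Real.dist_eq, sub_zero, abs_of_nonneg hs0]))
  suffices hlim : Tendsto (fun n => ∑ i ∈ Finset.range E.1, dist (f n (E.2 i).1) (f n (E.2 i).2)) atTop
      (𝓝 (∑ i ∈ Finset.range E.1, dist (g (E.2 i).1) (g (E.2 i).2))) by
    exact le_of_tendsto' hlim fun n => (h n).sum_dist_le hp (h1 n) ha hab hE
  refine tendsto_finsetSum _ fun i hi => ?_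
  have hi' := hE.1 i hi
  rw [uIcc_of_le hab] at hi'
  exact (hg _ (ha.trans_le hi'.1.1)).dist (hg _ (ha.trans_le hi'.2.1))

theorem rpow_setLIntegral_le {p : ℝ} (hp : 1 < p) {F : ℝ → ℝ≥0∞} {S : Set ℝ}
    (hF : AEMeasurable F (volume.restrict S)) :
    (∫⁻ x in S, F x) ^ p ≤ (∫⁻ x in S, F x ^ p) * volume S ^ (p - 1) := by
  have hpq : p.HolderConjugate (p / (p - 1)) := Real.HolderConjugate.conjExponent hp
  have h := ENNReal.lintegral_mul_le_Lp_mul_Lq _ hpq hF (aemeasurable_const (b := (1 : ℝ≥0∞)))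
  simp only [Pi.mul_apply, mul_one, ENNReal.one_rpow, lintegral_const, one_mul,
    Measure.restrict_apply_univ] at h
  have h2 := ENNReal.rpow_le_rpow h (show 0 ≤ p by linarith)
  rw [ENNReal.mul_rpow_of_nonneg _ _ (by linarith), ← ENNReal.rpow_mul, ← ENNReal.rpow_mul,
    one_div_mul_cancel (by linarith), ENNReal.rpow_one] at h2
  have : 1 / (p / (p - 1)) * p = p - 1 := by
    have : p ≠ 0 := by linarith
    have : p - 1 ≠ 0 := by linarith
    field_simp
  rwa [this] at h2

/-- Difference quotients are dominated by the derivative in `L^p` with an increasing weight. -/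
theorem MemX.lintegral_diffQuot_le {p α θ : ℝ} (hp : 2 ≤ p) (hα : 0 ≤ α) {u u' : ℝ → ℝ}
    (h : MemX p α θ u u') {d : ℝ} (hd : 0 < d) :
    (wInt α fun r => |(u (r + d) - u r) / d| ^ p) ≤ wInt α fun r => |u' r| ^ p := by
  have hm : AEMeasurable u' (volume.restrict (Ioi (0 : ℝ))) := h.aemeasurable_deriv
  unfold wInt
  gcongr 1
  have hpt : ∀ r ∈ Ioi (0 : ℝ), ENNReal.ofReal (|(u (r + d) - u r) / d| ^ p) *
      ENNReal.ofReal (r ^ α) ≤ ENNReal.ofReal d⁻¹ * ∫⁻ x in Ioi (0 : ℝ),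
        (Ioc r (r + d)).indicator (fun x => ENNReal.ofReal (|u' x| ^ p) * ENNReal.ofReal (r ^ α)) x := by
    intro r hr
    have hr : 0 < r := hr
    have hsub : Ioc r (r + d) ⊆ Ioi 0 := fun x hx => hr.trans hx.1
    have hmr : AEMeasurable u' (volume.restrict (Ioc r (r + d))) :=
      hm.mono_measure (Measure.restrict_mono hsub le_rfl)
    have h1 := h.abs_sub_le_lintegral hr (show r ≤ r + d by linarith)
    have h2 : ENNReal.ofReal (|u (r + d) - u r|) ^ p ≤
        (∫⁻ x in Ioc r (r + d), ENNReal.ofReal (|u' x| ^ p)) * ENNReal.ofReal (d ^ (p - 1)) := by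
      refine (ENNReal.rpow_le_rpow h1 (by linarith)).trans
        ((rpow_setLIntegral_le (by linarith) (by fun_prop)).trans_eq ?_)
      rw [Real.volume_Ioc, add_sub_cancel_left, ENNReal.ofReal_rpow_of_pos hd]
      congr 2
      ext x
      rw [ENNReal.ofReal_rpow_of_nonneg (abs_nonneg _) (by linarith)]
    rw [setLIntegral_indicator measurableSet_Ioc, inter_eq_left.2 hsub,
      lintegral_mul_const'' _ (by fun_prop), ← mul_assoc]
    gcongr
    rw [abs_div, abs_of_pos hd, Real.div_rpow (abs_nonneg _) hd.le, div_eq_mul_inv,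
      ENNReal.ofReal_mul (by positivity), ← ENNReal.ofReal_rpow_of_nonneg (abs_nonneg _) (by linarith)]
    refine (mul_le_mul_left h2 _).trans_eq ?_
    rw [mul_assoc, ← ENNReal.ofReal_mul (by positivity), mul_comm]
    congr 2
    rw [Real.rpow_sub_one hd.ne']
    have := (Real.rpow_pos_of_pos hd p).ne'
    field_simp
  refine (setLIntegral_mono' measurableSet_Ioi hpt).trans ?_
  rw [lintegral_const_mul' _ _ ENNReal.ofReal_ne_top]
  have hswap : ∫⁻ r in Ioi (0 : ℝ), ∫⁻ x in Ioi (0 : ℝ),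
        (Ioc r (r + d)).indicator (fun x => ENNReal.ofReal (|u' x| ^ p) * ENNReal.ofReal (r ^ α)) x
      = ∫⁻ x in Ioi (0 : ℝ), ∫⁻ r in Ioi (0 : ℝ),
        (Ioc r (r + d)).indicator (fun x => ENNReal.ofReal (|u' x| ^ p) * ENNReal.ofReal (r ^ α)) x := by
    apply lintegral_lintegral_swap
    have hset : MeasurableSet {z : ℝ × ℝ | z.2 ∈ Ioc z.1 (z.1 + d)} :=
      (measurableSet_lt measurable_fst measurable_snd).inter
        (measurableSet_le measurable_snd (measurable_fst.add_const d))
    have hm2 : AEMeasurable (fun z : ℝ × ℝ => u' z.2)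
        ((volume.restrict (Ioi (0 : ℝ))).prod (volume.restrict (Ioi (0 : ℝ)))) := hm.comp_snd
    have : AEMeasurable (fun z : ℝ × ℝ => ENNReal.ofReal (|u' z.2| ^ p) * ENNReal.ofReal (z.1 ^ α))
        ((volume.restrict (Ioi (0 : ℝ))).prod (volume.restrict (Ioi (0 : ℝ)))) := by fun_prop
    refine (this.indicator hset).congr (Eventually.of_forall fun z => ?_)
    simp only [Function.uncurry, indicator, mem_ofPred_eq]
  rw [hswap, ← lintegral_const_mul' _ _ ENNReal.ofReal_ne_top]
  refine setLIntegral_mono' measurableSet_Ioi fun x hx => ?_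
  have hx : 0 < x := hx
  calc _ ≤ ENNReal.ofReal d⁻¹ * ∫⁻ r in Ioi (0 : ℝ), (Ico (x - d) x).indicator
          (fun _ => ENNReal.ofReal (|u' x| ^ p) * ENNReal.ofReal (x ^ α)) r := by
        gcongr 1
        refine setLIntegral_mono' measurableSet_Ioi fun r hr => ?_
        have hr : 0 < r := hr
        by_cases hxr : x ∈ Ioc r (r + d)
        · have : r ∈ Ico (x - d) x := ⟨by linarith [hxr.2], hxr.1⟩
          rw [indicator_of_mem hxr, indicator_of_mem this]
          gcongr
          exact hxr.1.le
        · rw [indicator_of_notMem hxr]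
          exact zero_le
    _ ≤ ENNReal.ofReal d⁻¹ * (ENNReal.ofReal (|u' x| ^ p) * ENNReal.ofReal (x ^ α) *
          ENNReal.ofReal d) := by
        gcongr 1
        refine (setLIntegral_le_lintegral _ _).trans ?_
        rw [lintegral_indicator_const measurableSet_Ico, Real.volume_Ico, _root_.sub_sub_cancel]
    _ = _ := by
        rw [mul_comm, mul_assoc, ← ENNReal.ofReal_mul hd.le, mul_inv_cancel₀ hd.ne',
          ENNReal.ofReal_one, mul_one]

theorem lintegral_le_liminf_of_tendsto {μ : Measure ℝ} {F : ℕ → ℝ → ℝ≥0∞} {G : ℝ → ℝ≥0∞}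
    (hF : ∀ n, AEMeasurable (F n) μ) (h : ∀ᵐ r ∂μ, Tendsto (fun n => F n r) atTop (𝓝 (G r))) :
    ∫⁻ r, G r ∂μ ≤ liminf (fun n => ∫⁻ r, F n r ∂μ) atTop := by
  refine le_trans (le_of_eq ?_) (lintegral_liminf_le' hF)
  exact lintegral_congr_ae (h.mono fun r hr => hr.liminf_eq.symm)

theorem lintegral_deriv_le_liminf {p θ : ℝ} (hp : 2 ≤ p) {f f' : ℕ → ℝ → ℝ} {g : ℝ → ℝ}
    (h : ∀ n, MemX p (p - 1) θ (f n) (f' n))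
    (h1 : ∀ n, (wInt (p - 1) fun r => |f' n r| ^ p) ≤ 1)
    (hg : ∀ r, 0 < r → Tendsto (fun n => f n r) atTop (𝓝 (g r))) :
    (wInt (p - 1) fun r => |deriv g r| ^ p) ≤
      liminf (fun n => wInt (p - 1) fun r => |f' n r| ^ p) atTop := by
  have hac : ∀ a b, 0 < a → a ≤ b → AbsolutelyContinuousOnInterval g a b := fun a b ha hab =>
    absolutelyContinuousOnInterval_of_tendsto hp h h1 hg ha hab
  have hgc : ContinuousOn g (Ioi 0) := by
    intro x hx
    have hx : 0 < x := hx
    have := (hac (x / 2) (2 * x) (by linarith) (by linarith)).continuousOn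
    rw [uIcc_of_le (by linarith)] at this
    exact (this.continuousAt (Icc_mem_nhds (by linarith) (by linarith))).continuousWithinAt
  have hquot : ∀ v : ℝ → ℝ, ContinuousOn v (Ioi 0) → ∀ d, 0 < d →
      AEMeasurable (fun r => ENNReal.ofReal (|(v (r + d) - v r) / d| ^ p)) (wMeas (p - 1)) := by
    intro v hv d hd
    have h2 : ContinuousOn (fun r => v (r + d)) (Ioi 0) :=
      hv.comp (by fun_prop) fun r hr => by
        have : 0 < r := hr
        exact mem_Ioi.2 (by linarith)
    have h3 : AEMeasurable (fun r => v (r + d) - v r) (wMeas (p - 1)) :=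
      ((h2.sub hv).aemeasurable measurableSet_Ioi).mono_ac (wMeas_absolutelyContinuous _)
    fun_prop
  have hD : ∀ d, 0 < d → (∫⁻ r, ENNReal.ofReal (|(g (r + d) - g r) / d| ^ p) ∂wMeas (p - 1)) ≤
      liminf (fun n => wInt (p - 1) fun r => |f' n r| ^ p) atTop := by
    intro d hd
    refine (lintegral_le_liminf_of_tendsto (fun n => hquot (f n) (h n).continuousOn d hd)
      (ae_wMeas_of_forall_pos fun r hr => ?_)).trans ?_
    · refine ENNReal.tendsto_ofReal ?_
      refine Tendsto.rpow_const ?_ (Or.inr (by linarith))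
      exact (((hg _ (by linarith)).sub (hg _ hr)).div_const d).abs
    · refine liminf_le_liminf (Eventually.of_forall fun n => ?_)
      rw [← wInt_eq_lintegral (p - 1) fun r => |(f n (r + d) - f n r) / d| ^ p]
      exact (h n).lintegral_diffQuot_le hp (by linarith) hd
  have hdiff : ∀ᵐ r ∂wMeas (p - 1), DifferentiableAt ℝ g r := by
    refine (wMeas_absolutelyContinuous _).ae_le ((ae_restrict_iff' measurableSet_Ioi).2 ?_)
    have : ∀ᵐ r : ℝ, ∀ n : ℕ, r ∈ uIcc ((n + 1 : ℝ)⁻¹) (n + 1 : ℝ) → DifferentiableAt ℝ g r := by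
      rw [ae_all_iff]
      intro n
      refine (hac _ _ (by positivity) ?_).ae_differentiableAt
      have : (1 : ℝ) ≤ n + 1 := by linarith [n.cast_nonneg (α := ℝ)]
      exact (inv_le_one_of_one_le₀ this).trans this
    filter_upwards [this] with r hr hr0
    have hr0 : 0 < r := hr0
    obtain ⟨n, hn⟩ := exists_nat_gt (max r r⁻¹)
    have h1 := le_max_left r r⁻¹
    have h2 := le_max_right r r⁻¹
    refine hr n (Icc_subset_uIcc ⟨?_, by linarith⟩)
    rw [inv_le_comm₀ (by positivity) hr0]
    linarith
  have hseq : Tendsto (fun m : ℕ => (1 / ((m : ℝ) + 1))) atTop (𝓝[≠] 0) :=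
    tendsto_nhdsWithin_iff.2 ⟨tendsto_one_div_add_atTop_nhds_zero_nat,
      Eventually.of_forall fun m => by
        simp only [mem_compl_iff, mem_singleton_iff]
        positivity⟩
  rw [wInt_eq_lintegral]
  refine (lintegral_le_liminf_of_tendsto (fun m : ℕ => hquot g hgc (1 / ((m : ℝ) + 1))
    (by positivity)) (hdiff.mono fun r hr => ?_)).trans ?_
  · refine ENNReal.tendsto_ofReal ?_
    refine Tendsto.rpow_const ?_ (Or.inr (by linarith))
    have := (hr.hasDerivAt.tendsto_slope_zero).comp hseq
    refine (this.congr fun m => ?_).abs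
    simp only [Function.comp_apply, smul_eq_mul]
    rw [inv_mul_eq_div]
  · refine (liminf_le_liminf (Eventually.of_forall fun m : ℕ =>
      hD (1 / ((m : ℝ) + 1)) (by positivity))).trans_eq ?_
    exact liminf_const _

theorem memX_of_tendsto {p θ : ℝ} (hp : 2 ≤ p) (hθ : 0 ≤ θ) {f f' : ℕ → ℝ → ℝ} {g : ℝ → ℝ}
    (h : ∀ n, MemX p (p - 1) θ (f n) (f' n))
    (h0 : ∀ n, (wInt θ fun r => |f n r| ^ p) ≤ 1)
    (h1 : ∀ n, (wInt (p - 1) fun r => |f' n r| ^ p) ≤ 1)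
    (hg : ∀ r, 0 < r → Tendsto (fun n => f n r) atTop (𝓝 (g r))) :
    MemX p (p - 1) θ g (deriv g) ∧
      (wInt θ fun r => |g r| ^ p) ≤ liminf (fun n => wInt θ fun r => |f n r| ^ p) atTop := by
  have hac : ∀ a b, 0 < a → a ≤ b → AbsolutelyContinuousOnInterval g a b := fun a b ha hab =>
    absolutelyContinuousOnInterval_of_tendsto hp h h1 hg ha hab
  have hle : ∀ a : ℕ → ℝ≥0∞, (∀ n, a n ≤ 1) → liminf a atTop < ⊤ := fun a ha =>
    lt_of_le_of_lt ((liminf_le_liminf (Eventually.of_forall ha)).trans_eq (liminf_const _))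
      one_lt_top
  have hG : (wInt θ fun r => |g r| ^ p) ≤ liminf (fun n => wInt θ fun r => |f n r| ^ p) atTop := by
    simp_rw [wInt_eq_lintegral]
    refine lintegral_le_liminf_of_tendsto (fun n => ?_) (ae_wMeas_of_forall_pos fun r hr => ?_)
    · have := (h n).aemeasurable.mono_ac (wMeas_absolutelyContinuous θ)
      fun_prop
    · exact ENNReal.tendsto_ofReal ((hg r hr).abs.rpow_const (Or.inr (by linarith)))
  refine ⟨⟨fun a b ha hab => (hac a b ha hab).intervalIntegrable_deriv,
    fun a b ha hab => (hac a b ha hab).integral_deriv_eq_sub.symm, ?_, ?_, ?_⟩, hG⟩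
  · rw [Metric.tendsto_atTop]
    intro ε hε
    obtain ⟨R, hR1, hR⟩ := exists_forall_abs_le hp hθ (half_pos hε)
    refine ⟨R, fun r hr => ?_⟩
    rw [Real.dist_eq, sub_zero]
    have : |g r| ≤ ε / 2 := le_of_tendsto' (hg r (by linarith)).abs
      fun n => hR _ _ (h n) (h0 n) (h1 n) r hr
    linarith
  · rw [wNorm_lt_top_iff (by linarith)]
    exact hG.trans_lt (hle _ h0)
  · rw [wNorm_lt_top_iff (by linarith)]
    exact (lintegral_deriv_le_liminf hp h h1 hg).trans_lt (hle _ h1)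

theorem one_add_rpow_le {q e y : ℝ} (hq : 0 < q) (he : 0 < e) (hy : 0 ≤ y) :
    (1 + y) ^ q ≤ (1 + e) ^ q * y ^ q + (1 + e⁻¹) ^ q := by
  rcases le_total (e * y) 1 with h | h
  · have : y ≤ e⁻¹ := by rwa [← one_div, le_div_iff₀ he, mul_comm]
    have h1 : (1 + y) ^ q ≤ (1 + e⁻¹) ^ q := Real.rpow_le_rpow (by positivity) (by linarith) hq.le
    have : 0 ≤ (1 + e) ^ q * y ^ q := by positivity
    linarith
  · have h1 : (1 + y) ^ q ≤ ((1 + e) * y) ^ q :=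
      Real.rpow_le_rpow (by positivity) (by linarith) hq.le
    rw [Real.mul_rpow (by positivity) hy] at h1
    have : 0 ≤ (1 + e⁻¹) ^ q := by positivity
    linarith

/-- A uniform exponential bound near the origin for the unit ball of `X`, below the critical
exponent. -/
theorem exists_forall_exp_le {p θ σ : ℝ} (hp : 2 ≤ p) (hσ : 0 ≤ σ)
    (hσμ : σ < muC (p - 1) θ) :
    ∃ β M : ℝ, β < θ + 1 ∧ 0 ≤ M ∧ ∀ u u' : ℝ → ℝ, MemX p (p - 1) θ u u' →
      (wInt (p - 1) fun r => |u' r| ^ p) ≤ 1 → ∀ R r, 0 < r → r ≤ R → |u R| ≤ 1 →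
      Real.exp (σ * |u r| ^ (p / (p - 1))) ≤ M * (R / r) ^ β := by
  have hω : 0 < omegaW (p - 1) := omegaW_pos (by linarith)
  have hp1 : 0 < p - 1 := by linarith
  set q := p / (p - 1) with hq
  have hq0 : 0 < q := div_pos (by linarith) hp1
  set C := omegaW (p - 1) ^ (-(1 / p)) with hC
  have hCq : C ^ q = (omegaW (p - 1) ^ (1 / (p - 1)))⁻¹ := by
    rw [hC, ← Real.rpow_mul hω.le, ← Real.rpow_neg hω.le]
    congr 1
    rw [hq]
    have : p ≠ 0 := by linarith
    field_simp
  have hlt : σ * C ^ q < θ + 1 := by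
    rw [hCq, ← div_eq_mul_inv, div_lt_iff₀ (by positivity)]
    exact hσμ
  have hcont : Tendsto (fun e : ℝ => σ * ((1 + e) ^ q * C ^ q)) (𝓝[>] 0) (𝓝 (σ * C ^ q)) := by
    have : Continuous (fun e : ℝ => σ * ((1 + e) ^ q * C ^ q)) := by
      have := hq0.le
      fun_prop (disch := assumption)
    have h2 := this.tendsto 0
    rw [add_zero, Real.one_rpow, one_mul] at h2
    exact h2.mono_left nhdsWithin_le_nhds
  obtain ⟨e, he, he0⟩ := ((hcont.eventually (gt_mem_nhds hlt)).and self_mem_nhdsWithin).exists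
  have he0 : 0 < e := he0
  refine ⟨σ * ((1 + e) ^ q * C ^ q), Real.exp (σ * (1 + e⁻¹) ^ q), he, (Real.exp_pos _).le,
    fun u u' hu h1 R r hr hrR huR => ?_⟩
  have hlog : 0 ≤ Real.log (R / r) := Real.log_nonneg ((one_le_div hr).2 hrR)
  set L := Real.log (R / r) with hL
  have h2 := hu.abs_sub_le hp h1 hr hrR
  have h3 : |u r| ≤ 1 + C * L ^ ((p - 1) / p) := by
    have := abs_sub_abs_le_abs_sub (u r) (u R)
    rw [abs_sub_comm] at this
    linarith
  have h4 : |u r| ^ q ≤ (1 + e) ^ q * C ^ q * L + (1 + e⁻¹) ^ q := by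
    refine (Real.rpow_le_rpow (abs_nonneg _) h3 hq0.le).trans
      ((one_add_rpow_le hq0 he0 (by positivity)).trans_eq ?_)
    rw [Real.mul_rpow (by positivity) (by positivity), ← Real.rpow_mul hlog]
    have : (p - 1) / p * q = 1 := by
      have : p ≠ 0 := by linarith
      rw [hq]; field_simp
    rw [this, Real.rpow_one]
    ring
  rw [Real.rpow_def_of_pos (div_pos (hr.trans_le hrR) hr), ← Real.exp_add, Real.exp_le_exp]
  refine (mul_le_mul_of_nonneg_left h4 hσ).trans_eq ?_
  rw [← hL]
  ring

theorem setLIntegral_wMeas_rpow_lt_top {θ β M R : ℝ} (hβ : β < θ + 1) (hM : 0 ≤ M) (hR : 0 < R) :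
    ∫⁻ r in Ioc 0 R, ENNReal.ofReal (M * (R / r) ^ β) ∂wMeas θ < ⊤ := by
  rw [← lintegral_indicator measurableSet_Ioc, lintegral_wMeas]
  refine ENNReal.mul_lt_top ENNReal.ofReal_lt_top ?_
  have hint : IntegrableOn (fun r : ℝ => M * R ^ β * r ^ (θ - β)) (Ioc 0 R) := by
    have := intervalIntegral.intervalIntegrable_rpow' (a := 0) (b := R) (r := θ - β) (by linarith)
    rw [intervalIntegrable_iff_integrableOn_Ioc_of_le hR.le] at this
    exact this.const_mul _
  have h2 := hint.lintegral_lt_top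
  refine lt_of_le_of_lt ?_ h2
  rw [← lintegral_indicator measurableSet_Ioc]
  refine (setLIntegral_mono' measurableSet_Ioi fun r hr => ?_).trans
    (setLIntegral_le_lintegral (Ioi 0) _)
  by_cases hr' : r ∈ Ioc 0 R
  · rw [indicator_of_mem hr', indicator_of_mem hr']
    have h0 := hr'.1
    rw [← ENNReal.ofReal_mul (by positivity), Real.div_rpow hR.le h0.le, Real.rpow_sub h0]
    apply ENNReal.ofReal_le_ofReal
    apply le_of_eq
    ring
  · rw [indicator_of_notMem hr', zero_mul]
    exact zero_le

/-- Compactness of the subcritical functional with its leading term removed, up to `ε`. -/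
theorem exists_tendsto_lintegral_expTail {p θ σ : ℝ} {k : ℕ} (hk : (k : ℝ) = p - 1) (hp : 2 ≤ p)
    (hθ : 0 ≤ θ) (hσ : 0 < σ) (hσμ : σ < muC (p - 1) θ) {f f' : ℕ → ℝ → ℝ} {g : ℝ → ℝ}
    (h : ∀ n, MemX p (p - 1) θ (f n) (f' n))
    (h0 : ∀ n, (wInt θ fun r => |f n r| ^ p) ≤ 1)
    (h1 : ∀ n, (wInt (p - 1) fun r => |f' n r| ^ p) ≤ 1)
    (hg : ∀ r, 0 < r → Tendsto (fun n => f n r) atTop (𝓝 (g r))) {ε : ℝ} (hε : 0 < ε) :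
    ∃ (I : ℕ → ℝ≥0∞) (I₀ : ℝ≥0∞), Tendsto I atTop (𝓝 I₀) ∧
      I₀ ≤ ∫⁻ r, ENNReal.ofReal (expTail k (σ * |g r| ^ (p / (p - 1)))) ∂wMeas θ ∧
      ∀ n, ∫⁻ r, ENNReal.ofReal (expTail k (σ * |f n r| ^ (p / (p - 1)))) ∂wMeas θ ≤
        I n + ENNReal.ofReal ε := by
  have hp1 : 0 < p - 1 := by linarith
  set q := p / (p - 1) with hq
  have hq0 : 0 < q := div_pos (by linarith) hp1
  have hcont : Tendsto (fun η : ℝ => σ ^ k * ((σ * η ^ q) * Real.exp (σ * η ^ q)))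
      (𝓝[>] 0) (𝓝 0) := by
    have : Continuous (fun η : ℝ => σ ^ k * ((σ * η ^ q) * Real.exp (σ * η ^ q))) := by
      have := hq0.le
      fun_prop (disch := assumption)
    have h2 := this.tendsto 0
    simp only [Real.zero_rpow hq0.ne', mul_zero, zero_mul] at h2
    exact h2.mono_left nhdsWithin_le_nhds
  have hone : ∀ᶠ η : ℝ in 𝓝[>] 0, η < 1 := nhdsWithin_le_nhds (gt_mem_nhds one_pos)
  obtain ⟨η, ⟨hη, hη1⟩, hη0⟩ :=
    (((hcont.eventually (gt_mem_nhds hε)).and hone).and self_mem_nhdsWithin).exists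
  have hη0 : 0 < η := hη0
  obtain ⟨R, hR1, hR⟩ := exists_forall_abs_le hp hθ hη0
  obtain ⟨β, M, hβ, hM, hexp⟩ := exists_forall_exp_le hp hσ.le hσμ
  have hmeas : ∀ n, AEMeasurable (fun r => ENNReal.ofReal (expTail k (σ * |f n r| ^ q)))
      (wMeas θ) := by
    intro n
    have := (h n).aemeasurable.mono_ac (wMeas_absolutelyContinuous θ)
    have h2 : AEMeasurable (fun r => σ * |f n r| ^ q) (wMeas θ) := by fun_prop
    exact ((continuous_expTail k).measurable.comp_aemeasurable h2).ennreal_ofReal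
  refine ⟨fun n => ∫⁻ r in Ioc 0 R, ENNReal.ofReal (expTail k (σ * |f n r| ^ q)) ∂wMeas θ,
    ∫⁻ r in Ioc 0 R, ENNReal.ofReal (expTail k (σ * |g r| ^ q)) ∂wMeas θ, ?_,
    setLIntegral_le_lintegral _ _, fun n => ?_⟩
  · refine tendsto_lintegral_of_dominated_convergence'
      (fun r => ENNReal.ofReal (M * (R / r) ^ β)) (fun n => (hmeas n).restrict) (fun n => ?_)
      (setLIntegral_wMeas_rpow_lt_top hβ hM (by linarith)).ne ?_
    · filter_upwards [ae_restrict_mem measurableSet_Ioc] with r hr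
      apply ENNReal.ofReal_le_ofReal
      exact (expTail_le_exp k (by positivity)).trans (hexp _ _ (h n) (h1 n) R r hr.1 hr.2
        ((hR _ _ (h n) (h0 n) (h1 n) R le_rfl).trans hη1.le))
    · filter_upwards [ae_restrict_mem measurableSet_Ioc] with r hr
      refine ENNReal.tendsto_ofReal (((continuous_expTail k).tendsto _).comp ?_)
      exact ((hg r hr.1).abs.rpow_const (Or.inr hq0.le)).const_mul σ
  · rw [← lintegral_add_compl _ (measurableSet_Ioc (a := (0 : ℝ)) (b := R))]
    gcongr 1
    calc ∫⁻ r in (Ioc 0 R)ᶜ, ENNReal.ofReal (expTail k (σ * |f n r| ^ q)) ∂wMeas θ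
        ≤ ∫⁻ r in (Ioc 0 R)ᶜ, ENNReal.ofReal ε * ENNReal.ofReal (|f n r| ^ p) ∂wMeas θ := by
          refine lintegral_mono_ae ?_
          filter_upwards [ae_restrict_mem measurableSet_Ioc.compl,
            ae_restrict_of_ae (ae_wMeas_of_forall_pos (θ := θ) (P := fun r => 0 < r)
              fun r hr => hr)] with r hr hr0
          have hrR : R ≤ r := by
            by_contra! hcon
            exact hr ⟨hr0, hcon.le⟩
          have h5 := hR _ _ (h n) (h0 n) (h1 n) r hrR
          have h6 : |f n r| ^ q ≤ η ^ q := Real.rpow_le_rpow (abs_nonneg _) h5 hq0.le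
          have h7 : (σ * |f n r| ^ q) ^ k = σ ^ k * |f n r| ^ p := by
            rw [mul_pow, ← Real.rpow_mul_natCast (abs_nonneg _), hk, hq,
              div_mul_cancel₀ _ hp1.ne']
          rw [← ENNReal.ofReal_mul hε.le]
          apply ENNReal.ofReal_le_ofReal
          refine (expTail_le k (by positivity)).trans ?_
          rw [pow_succ, h7]
          calc σ ^ k * |f n r| ^ p * (σ * |f n r| ^ q) * Real.exp (σ * |f n r| ^ q)
              ≤ σ ^ k * |f n r| ^ p * (σ * η ^ q) * Real.exp (σ * η ^ q) := by gcongr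
            _ = σ ^ k * (σ * η ^ q * Real.exp (σ * η ^ q)) * |f n r| ^ p := by ring
            _ ≤ ε * |f n r| ^ p := by gcongr
      _ ≤ ∫⁻ r, ENNReal.ofReal ε * ENNReal.ofReal (|f n r| ^ p) ∂wMeas θ :=
          setLIntegral_le_lintegral _ _
      _ = ENNReal.ofReal ε * wInt θ fun r => |f n r| ^ p := by
          rw [lintegral_const_mul' _ _ ENNReal.ofReal_ne_top, wInt_eq_lintegral]
      _ ≤ ENNReal.ofReal ε * 1 := by gcongr; exact h0 n
      _ = ENNReal.ofReal ε := mul_one _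

theorem wInt_comp_div (θ : ℝ) (f : ℝ → ℝ) {τ : ℝ} (hτ : 0 < τ) :
    (wInt θ fun r => f (r / τ)) = ENNReal.ofReal (τ ^ (θ + 1)) * wInt θ f := by
  have himg : (fun x : ℝ => τ * x) '' Ioi 0 = Ioi 0 := by
    rw [image_mul_left_Ioi hτ, mul_zero]
  have hcv := lintegral_image_eq_lintegral_abs_deriv_mul (s := Ioi (0 : ℝ)) (f := fun x => τ * x)
    (f' := fun _ => τ) measurableSet_Ioi
    (fun x _ => by simpa using ((hasDerivAt_id x).const_mul τ).hasDerivWithinAt)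
    (fun x _ y _ hxy => mul_left_cancel₀ hτ.ne' hxy)
    (fun r => ENNReal.ofReal (f (r / τ)) * ENNReal.ofReal (r ^ θ))
  rw [himg] at hcv
  unfold wInt
  rw [hcv, mul_left_comm, ← lintegral_const_mul' (ENNReal.ofReal (τ ^ (θ + 1))) _
    ENNReal.ofReal_ne_top]
  congr 1
  refine setLIntegral_congr_fun measurableSet_Ioi fun r hr => ?_
  have hr : 0 < r := hr
  rw [mul_div_cancel_left₀ _ hτ.ne', abs_of_pos hτ, Real.mul_rpow hτ.le hr.le,
    ENNReal.ofReal_mul (by positivity), Real.rpow_add_one hτ.ne', mul_comm (τ ^ θ),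
    ENNReal.ofReal_mul hτ.le]
  ring

theorem wInt_const_mul (θ : ℝ) (f : ℝ → ℝ) {c : ℝ} (hc : 0 ≤ c) :
    (wInt θ fun r => c * f r) = ENNReal.ofReal c * wInt θ f := by
  simp_rw [wInt_eq_lintegral]
  rw [← lintegral_const_mul' _ _ ENNReal.ofReal_ne_top]
  simp_rw [ENNReal.ofReal_mul hc]

theorem wInt_dilate (p θ : ℝ) (u : ℝ → ℝ) {s τ : ℝ} (hs : 0 < s) (hτ : 0 < τ) :
    (wInt θ fun r => |s * u (r / τ)| ^ p) =
      ENNReal.ofReal (s ^ p * τ ^ (θ + 1)) * wInt θ fun r => |u r| ^ p := by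
  have : ∀ r, |s * u (r / τ)| ^ p = s ^ p * |u (r / τ)| ^ p := fun r => by
    rw [abs_mul, abs_of_pos hs, Real.mul_rpow hs.le (abs_nonneg _)]
  simp_rw [this]
  rw [wInt_const_mul _ _ (by positivity), wInt_comp_div θ (fun r => |u r| ^ p) hτ, ← mul_assoc,
    ← ENNReal.ofReal_mul (by positivity)]

theorem wInt_dilate_deriv (p : ℝ) (v : ℝ → ℝ) {s τ : ℝ} (hs : 0 < s) (hτ : 0 < τ) :
    (wInt (p - 1) fun r => |s / τ * v (r / τ)| ^ p) =
      ENNReal.ofReal (s ^ p) * wInt (p - 1) fun r => |v r| ^ p := by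
  rw [wInt_dilate p (p - 1) v (div_pos hs hτ) hτ, Real.div_rpow hs.le hτ.le, sub_add_cancel,
    div_mul_cancel₀ _ (by positivity)]

theorem MemX.dilate {p θ : ℝ} (hp : 0 < p) {u u' : ℝ → ℝ} (h : MemX p (p - 1) θ u u') {s τ : ℝ}
    (hs : 0 < s) (hτ : 0 < τ) :
    MemX p (p - 1) θ (fun r => s * u (r / τ)) (fun r => s / τ * u' (r / τ)) := by
  refine ⟨fun a b ha hab => ?_, fun a b ha hab => ?_, ?_, ?_, ?_⟩
  · have h1 := h.ftc_int (a / τ) (b / τ) (by positivity) (by gcongr)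
    have h2 := (h1.comp_mul_right (c := τ⁻¹))
    simp only [div_inv_eq_mul, div_mul_cancel₀ _ hτ.ne', ← div_eq_mul_inv] at h2
    exact h2.const_mul _
  · have h1 := h.ftc (a / τ) (b / τ) (by positivity) (by gcongr)
    rw [intervalIntegral.integral_const_mul, intervalIntegral.integral_comp_div _ hτ.ne', ← h1,
      smul_eq_mul]
    field_simp
  · have h1 : Tendsto (fun r : ℝ => r / τ) atTop atTop := tendsto_id.atTop_div_const hτ
    have h2 := (h.lim_zero.comp h1).const_mul s
    rwa [mul_zero] at h2
  · rw [wNorm_lt_top_iff hp, wInt_dilate p θ u hs hτ]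
    exact ENNReal.mul_lt_top ENNReal.ofReal_lt_top ((wNorm_lt_top_iff hp u).1 h.fin_u)
  · rw [wNorm_lt_top_iff hp, wInt_dilate_deriv p u' hs hτ]
    exact ENNReal.mul_lt_top ENNReal.ofReal_lt_top ((wNorm_lt_top_iff hp u').1 h.fin_u')

theorem wInt_exp_neg_lt_top {p θ : ℝ} (hp : 0 < p) (hθ : 0 ≤ θ) :
    (wInt θ fun r => Real.exp (-r) ^ p) < ⊤ := by
  refine ENNReal.mul_lt_top ENNReal.ofReal_lt_top ?_
  have h := integrableOn_rpow_mul_exp_neg_mul_rpow (p := 1) (s := θ) (b := p) (by linarith)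
    one_pos hp
  refine lt_of_eq_of_lt ?_ h.lintegral_lt_top
  refine setLIntegral_congr_fun measurableSet_Ioi fun r hr => ?_
  have hr : 0 < r := hr
  simp only
  rw [← ENNReal.ofReal_mul (by positivity), ← Real.exp_mul, Real.rpow_one, mul_comm]
  congr 3
  ring

theorem memX_exp_neg {p θ : ℝ} (hp : 2 ≤ p) (hθ : 0 ≤ θ) :
    MemX p (p - 1) θ (fun r => Real.exp (-r)) (fun r => -Real.exp (-r)) := by
  have hd : ∀ r : ℝ, HasDerivAt (fun r => Real.exp (-r)) (-Real.exp (-r)) r := fun r => by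
    simpa using (hasDerivAt_neg r).exp
  have hc : Continuous fun r : ℝ => -Real.exp (-r) := by fun_prop
  refine ⟨fun a b _ _ => hc.intervalIntegrable _ _, fun a b _ _ => ?_,
    Real.tendsto_exp_neg_atTop_nhds_zero, ?_, ?_⟩
  · exact (intervalIntegral.integral_eq_sub_of_hasDerivAt (fun r _ => hd r)
      (hc.intervalIntegrable _ _)).symm
  · rw [wNorm_lt_top_iff (by linarith)]
    simpa only [Real.abs_exp] using wInt_exp_neg_lt_top (p := p) (by linarith) hθ
  · rw [wNorm_lt_top_iff (by linarith)]
    simpa only [abs_neg, Real.abs_exp] using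
      wInt_exp_neg_lt_top (p := p) (θ := p - 1) (by linarith) (by linarith)

theorem ae_eq_zero_of_wInt_eq_zero {p θ : ℝ} {u : ℝ → ℝ}
    (hu : AEMeasurable u (wMeas θ)) (h : (wInt θ fun r => |u r| ^ p) = 0) :
    ∀ᵐ r ∂wMeas θ, u r = 0 := by
  rw [wInt_eq_lintegral, lintegral_eq_zero_iff' (by fun_prop)] at h
  filter_upwards [h] with r hr
  by_contra hne
  have : 0 < |u r| ^ p := by positivity
  simp only [Pi.zero_apply, ENNReal.ofReal_eq_zero] at hr
  linarith

theorem wMeas_ne_zero {θ : ℝ} (hθ : 0 ≤ θ) : wMeas θ ≠ 0 := by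
  intro h0
  have h1 := lintegral_wMeas θ fun _ => 1
  rw [h0, lintegral_zero_measure, eq_comm, mul_eq_zero] at h1
  rcases h1 with h1 | h1
  · exact absurd (omegaW_pos hθ) (not_lt.2 (ENNReal.ofReal_eq_zero.1 h1))
  · simp only [one_mul] at h1
    rw [setLIntegral_eq_zero_iff measurableSet_Ioi (by fun_prop)] at h1
    have h2 : (Ioi (0 : ℝ)) ≤ᵐ[volume] (∅ : Set ℝ) := by
      filter_upwards [h1] with r hr hr0
      have hr0 : 0 < r := hr0
      have h3 := ENNReal.ofReal_eq_zero.1 (hr hr0)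
      exact absurd (Real.rpow_pos_of_pos hr0 θ) (not_lt.2 h3)
    have h3 := measure_mono_ae h2
    simp at h3

theorem TMfunc_le_TMC {p α θ σ : ℝ} (hp : 0 < p) {u u' : ℝ → ℝ} (h : MemX p α θ u u')
    (h1 : (wInt θ fun r => |u r| ^ p) + (wInt α fun r => |u' r| ^ p) ≤ 1) :
    TMfunc p θ σ u ≤ TMC p α θ σ := by
  unfold TMC
  exact le_iSup_of_le u (le_iSup_of_le u' (le_iSup_of_le h
    (le_iSup_of_le ((Xnorm_le_one_iff hp u u').2 h1) le_rfl)))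

/-- The vanishing level is a lower bound for the critical supremum. -/
theorem ofReal_le_TMC {p θ σ : ℝ} {k : ℕ} (hk : (k : ℝ) = p - 1) (hp : 2 ≤ p) (hθ : 0 ≤ θ)
    (hσ : 0 ≤ σ) :
    ENNReal.ofReal (σ ^ k / (Nat.factorial k : ℝ)) ≤ TMC p (p - 1) θ σ := by
  have hp0 : 0 < p := by linarith
  have hw := memX_exp_neg hp hθ
  set w : ℝ → ℝ := fun r => Real.exp (-r)
  set w' : ℝ → ℝ := fun r => -Real.exp (-r)
  set a := wInt θ fun r => |w r| ^ p with ha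
  set b := wInt (p - 1) fun r => |w' r| ^ p with hb
  have hat : a ≠ ⊤ := ((wNorm_lt_top_iff hp0 w).1 hw.fin_u).ne
  have hbt : b ≠ ⊤ := ((wNorm_lt_top_iff hp0 w').1 hw.fin_u').ne
  have ha0 : a ≠ 0 := by
    intro h0
    have h1 := ae_eq_zero_of_wInt_eq_zero
      (hw.aemeasurable.mono_ac (wMeas_absolutelyContinuous θ)) h0
    have h2 : ∀ᵐ r ∂wMeas θ, False := h1.mono fun r hr => (Real.exp_pos (-r)).ne' hr
    rw [eventually_false_iff_eq_bot, ae_eq_bot] at h2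
    exact wMeas_ne_zero hθ h2
  have hapos : 0 < a.toReal := ENNReal.toReal_pos ha0 hat
  have hlim : Tendsto (fun s : ℝ => s ^ p * b.toReal) (𝓝[>] 0) (𝓝 0) := by
    have : Continuous fun s : ℝ => s ^ p * b.toReal := by
      fun_prop (disch := linarith)
    have h2 := this.tendsto 0
    rw [Real.zero_rpow hp0.ne', zero_mul] at h2
    exact h2.mono_left nhdsWithin_le_nhds
  have hlim2 : Tendsto (fun s : ℝ => ENNReal.ofReal (σ ^ k / (Nat.factorial k : ℝ) *
      (1 - s ^ p * b.toReal))) (𝓝[>] 0)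
      (𝓝 (ENNReal.ofReal (σ ^ k / (Nat.factorial k : ℝ)))) := by
    have h2 := ENNReal.tendsto_ofReal ((tendsto_const_nhds (x := (1 : ℝ))).sub hlim |>.const_mul
      (σ ^ k / (Nat.factorial k : ℝ)))
    simpa only [sub_zero, mul_one] using h2
  refine le_of_tendsto hlim2 ?_
  filter_upwards [hlim.eventually (gt_mem_nhds one_pos), self_mem_nhdsWithin] with s hs1 hs0
  have hs0 : 0 < s := hs0
  set t := (1 - s ^ p * b.toReal) / (s ^ p * a.toReal) with ht
  have ht0 : 0 < t := div_pos (by linarith) (by positivity)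
  set τ := t ^ (1 / (θ + 1)) with hτ
  have hτ0 : 0 < τ := by positivity
  have hτt : τ ^ (θ + 1) = t := by
    rw [hτ, ← Real.rpow_mul ht0.le, one_div_mul_cancel (by linarith), Real.rpow_one]
  have hv := hw.dilate hp0 hs0 hτ0
  have hA : (wInt θ fun r => |s * w (r / τ)| ^ p) = ENNReal.ofReal (1 - s ^ p * b.toReal) := by
    rw [wInt_dilate p θ w hs0 hτ0, hτt, ← ha, ← ENNReal.ofReal_toReal hat,
      ← ENNReal.ofReal_mul (by positivity), ht]
    congr 1
    field_simp
  have hB : (wInt (p - 1) fun r => |s / τ * w' (r / τ)| ^ p) =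
      ENNReal.ofReal (s ^ p * b.toReal) := by
    rw [wInt_dilate_deriv p w' hs0 hτ0, ← hb, ENNReal.ofReal_mul (by positivity),
      ENNReal.ofReal_toReal hbt]
  have hle : TMfunc p θ σ (fun r => s * w (r / τ)) ≤ TMC p (p - 1) θ σ := by
    refine TMfunc_le_TMC hp0 hv ?_
    rw [hA, hB, ← ENNReal.ofReal_add (by linarith) (by positivity), sub_add_cancel,
      ENNReal.ofReal_one]
  refine le_trans ?_ hle
  rw [TMfunc_eq hk hp hσ hv.aemeasurable, hA, ← ENNReal.ofReal_mul (by positivity)]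
  exact le_self_add

/-- Attainment at a smaller exponent puts the supremum strictly above the vanishing level. -/
theorem ofReal_lt_TMC_of_attained {p θ σ₁ σ : ℝ} {k : ℕ} (hk : (k : ℝ) = p - 1) (hp : 2 ≤ p)
    (hθ : 0 ≤ θ) (hσ₁ : 0 < σ₁) (hlt : σ₁ < σ) (h : TMCAttained p (p - 1) θ σ₁) :
    ENNReal.ofReal (σ ^ k / (Nat.factorial k : ℝ)) < TMC p (p - 1) θ σ := by
  have hp0 : 0 < p := by linarith
  have hσ : 0 < σ := hσ₁.trans hlt
  obtain ⟨u, u', hu, hX, hT⟩ := h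
  rw [Xnorm_le_one_iff hp0] at hX
  refine lt_of_lt_of_le ?_ (TMfunc_le_TMC hp0 hu hX)
  have hlow := ofReal_le_TMC hk hp hθ hσ₁.le
  have hum := hu.aemeasurable.mono_ac (wMeas_absolutelyContinuous θ)
  rw [hT, TMfunc_eq hk hp hσ₁.le hu.aemeasurable] at hlow
  rw [TMfunc_eq hk hp hσ.le hu.aemeasurable]
  set q := p / (p - 1) with hq
  have hq0 : 0 < q := div_pos hp0 (by linarith)
  set A := wInt θ fun r => |u r| ^ p with hA
  set G := ∫⁻ r, ENNReal.ofReal (expTail k (σ₁ * |u r| ^ q)) ∂wMeas θ with hG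
  set l := σ / σ₁ with hl
  have hl1 : 1 < l := (one_lt_div hσ₁).2 hlt
  have hl0 : 0 < l := by linarith
  have hσl : σ = l * σ₁ := by rw [hl, div_mul_cancel₀ _ hσ₁.ne']
  have hGσ : ENNReal.ofReal (l ^ (k + 1)) * G ≤
      ∫⁻ r, ENNReal.ofReal (expTail k (σ * |u r| ^ q)) ∂wMeas θ := by
    rw [hG, ← lintegral_const_mul' _ _ ENNReal.ofReal_ne_top]
    refine lintegral_mono fun r => ?_
    rw [← ENNReal.ofReal_mul (by positivity), hσl, mul_assoc]
    exact ENNReal.ofReal_le_ofReal (expTail_mul_ge k hl1.le (by positivity))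
  refine lt_of_lt_of_le ?_ (add_le_add le_rfl hGσ)
  have hAt : A ≠ ⊤ := (lt_of_le_of_lt (le_self_add.trans hX) one_lt_top).ne
  have hG0 : G ≠ 0 := by
    intro h0
    have hA0 : A = 0 := by
      rw [hG, lintegral_eq_zero_iff'] at h0
      · rw [hA, wInt_eq_lintegral, lintegral_eq_zero_iff' (by fun_prop)]
        filter_upwards [h0] with r hr
        have : u r = 0 := by
          by_contra hne
          have h2 : 0 < σ₁ * |u r| ^ q := by positivity
          exact absurd (expTail_pos k h2) (not_lt.2 (ENNReal.ofReal_eq_zero.1 hr))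
        simp [this, Real.zero_rpow hp0.ne']
      · have h2 : AEMeasurable (fun r => σ₁ * |u r| ^ q) (wMeas θ) := by fun_prop
        exact ((continuous_expTail k).measurable.comp_aemeasurable h2).ennreal_ofReal
    rw [hA0, h0, mul_zero, add_zero, nonpos_iff_eq_zero, ENNReal.ofReal_eq_zero] at hlow
    have : 0 < σ₁ ^ k / (Nat.factorial k : ℝ) := by positivity
    linarith
  by_cases hGt : G = ⊤
  · rw [hGt, ENNReal.mul_top (by simpa using by positivity), add_top]
    exact ENNReal.ofReal_lt_top
  have hGpos : 0 < G.toReal := ENNReal.toReal_pos hG0 hGt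
  rw [← ENNReal.ofReal_toReal hAt, ← ENNReal.ofReal_toReal hGt,
    ← ENNReal.ofReal_mul (by positivity), ← ENNReal.ofReal_add (by positivity) (by positivity),
    ENNReal.ofReal_le_ofReal_iff (by positivity)] at hlow
  rw [← ENNReal.ofReal_toReal hAt, ← ENNReal.ofReal_toReal hGt,
    ← ENNReal.ofReal_mul (by positivity), ← ENNReal.ofReal_mul (by positivity),
    ← ENNReal.ofReal_add (by positivity) (by positivity),
    ENNReal.ofReal_lt_ofReal_iff_of_nonneg (by positivity)]
  calc σ ^ k / (Nat.factorial k : ℝ) = l ^ k * (σ₁ ^ k / (Nat.factorial k : ℝ)) := by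
        rw [hσl, mul_pow]; ring
    _ ≤ l ^ k * (σ₁ ^ k / (Nat.factorial k : ℝ) * A.toReal + G.toReal) := by gcongr
    _ = σ ^ k / (Nat.factorial k : ℝ) * A.toReal + l ^ k * G.toReal := by
        rw [hσl, mul_pow]; ring
    _ < σ ^ k / (Nat.factorial k : ℝ) * A.toReal + l ^ (k + 1) * G.toReal := by
        gcongr
        omega

/-- Every sequence in the unit ball of `X` has a subsequence converging pointwise on `(0, ∞)`. -/
theorem exists_subseq_tendsto_of_memX {p θ : ℝ} (hp : 2 ≤ p) (hθ : 0 ≤ θ) {f f' : ℕ → ℝ → ℝ}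
    (h : ∀ n, MemX p (p - 1) θ (f n) (f' n))
    (h0 : ∀ n, (wInt θ fun r => |f n r| ^ p) ≤ 1)
    (h1 : ∀ n, (wInt (p - 1) fun r => |f' n r| ^ p) ≤ 1) :
    ∃ (g : ℝ → ℝ) (φ : ℕ → ℕ), StrictMono φ ∧
      ∀ r, 0 < r → Tendsto (fun n => f (φ n) r) atTop (𝓝 (g r)) := by
  obtain ⟨R, hR1, hR⟩ := exists_forall_abs_le hp hθ one_pos
  set C := omegaW (p - 1) ^ (-(1 / p)) with hC
  have hp1 : 0 < (p - 1) / p := div_pos (by linarith) (by linarith)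
  refine exists_subseq_tendsto
    (B := fun r => 1 + C * |Real.log (r / R)| ^ ((p - 1) / p)) (fun n r hr => ?_)
    (fun r hr ε hε => ?_)
  · have h2 := (h n).abs_sub_le_abs_log hp (h1 n) (a := R) (by linarith) hr
    have h3 := hR _ _ (h n) (h0 n) (h1 n) R le_rfl
    have h4 : |f n r| ≤ |f n R| + |f n r - f n R| := by
      simpa using abs_add_le (f n R) (f n r - f n R)
    linarith
  · have hcont : ContinuousAt (fun s : ℝ => C * |Real.log (s / r)| ^ ((p - 1) / p)) r := by
      have hlog : ContinuousAt (fun s : ℝ => Real.log (s / r)) r :=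
        (continuousAt_id.div_const r).log (by simp [hr.ne'])
      exact continuousAt_const.mul (hlog.abs.rpow_const (Or.inr hp1.le))
    have hlim : Tendsto (fun s : ℝ => C * |Real.log (s / r)| ^ ((p - 1) / p)) (𝓝 r) (𝓝 0) := by
      have h2 := hcont.tendsto
      rwa [div_self hr.ne', Real.log_one, abs_zero, Real.zero_rpow hp1.ne', mul_zero] at h2
    obtain ⟨δ, hδ, hd⟩ := Metric.eventually_nhds_iff.1 (hlim.eventually (gt_mem_nhds hε))
    refine ⟨δ, hδ, fun s hs hsr n => ?_⟩
    exact ((h n).abs_sub_le_abs_log hp (h1 n) hr hs).trans (hd (by rwa [Real.dist_eq])).le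

/-- Data extracted from a maximizing sequence: a pointwise limit `g` together with the limit `A`
of the `L^p_θ` masses. -/
theorem exists_limit_profile {p θ σ : ℝ} {k : ℕ} (hk : (k : ℝ) = p - 1) (hp : 2 ≤ p)
    (hθ : 0 ≤ θ) (hσ : 0 < σ) (hσμ : σ < muC (p - 1) θ) {f f' : ℕ → ℝ → ℝ}
    (h : ∀ n, MemX p (p - 1) θ (f n) (f' n))
    (hle : ∀ n, (wInt θ fun r => |f n r| ^ p) + (wInt (p - 1) fun r => |f' n r| ^ p) ≤ 1)
    {M : ℝ≥0∞} (hM : Tendsto (fun n => TMfunc p θ σ (f n)) atTop (𝓝 M)) :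
    ∃ (g : ℝ → ℝ) (A : ℝ≥0∞), MemX p (p - 1) θ g (deriv g) ∧
      (wInt θ fun r => |g r| ^ p) ≤ A ∧
      A + (wInt (p - 1) fun r => |deriv g r| ^ p) ≤ 1 ∧
      M ≤ ENNReal.ofReal (σ ^ k / (Nat.factorial k : ℝ)) * A +
        ∫⁻ r, ENNReal.ofReal (expTail k (σ * |g r| ^ (p / (p - 1)))) ∂wMeas θ := by
  have h0 : ∀ n, (wInt θ fun r => |f n r| ^ p) ≤ 1 := fun n => le_self_add.trans (hle n)
  have h1 : ∀ n, (wInt (p - 1) fun r => |f' n r| ^ p) ≤ 1 := fun n => le_add_self.trans (hle n)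
  obtain ⟨g, φ, hφ, hg⟩ := exists_subseq_tendsto_of_memX hp hθ h h0 h1
  obtain ⟨A, -, ψ, hψ, hA⟩ := (isCompact_univ (X := ℝ≥0∞)).tendsto_subseq
    (x := fun n => wInt θ fun r => |f (φ n) r| ^ p) (fun _ => mem_univ _)
  set χ : ℕ → ℕ := fun n => φ (ψ n)
  have hχ : StrictMono χ := hφ.comp hψ
  have hA : Tendsto (fun n => wInt θ fun r => |f (χ n) r| ^ p) atTop (𝓝 A) := hA
  have hgχ : ∀ r, 0 < r → Tendsto (fun n => f (χ n) r) atTop (𝓝 (g r)) := fun r hr =>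
    (hg r hr).comp hψ.tendsto_atTop
  have hA1 : A ≤ 1 := le_of_tendsto' hA fun n => h0 _
  obtain ⟨hgX, hgA⟩ := memX_of_tendsto hp hθ (fun n => h (χ n)) (fun n => h0 (χ n))
    (fun n => h1 (χ n)) hgχ
  rw [hA.liminf_eq] at hgA
  refine ⟨g, A, hgX, hgA, ?_, ?_⟩
  · have hsub : Tendsto (fun n => 1 - wInt θ fun r => |f (χ n) r| ^ p) atTop (𝓝 (1 - A)) :=
      ENNReal.Tendsto.sub tendsto_const_nhds hA (Or.inl one_ne_top)
    have hd := lintegral_deriv_le_liminf hp (fun n => h (χ n)) (fun n => h1 (χ n)) hgχ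
    have hl : liminf (fun n => wInt (p - 1) fun r => |f' (χ n) r| ^ p) atTop ≤ 1 - A := by
      rw [← hsub.liminf_eq]
      refine liminf_le_liminf (Eventually.of_forall fun n => ?_)
      refine ENNReal.le_sub_of_add_le_left ?_ (hle (χ n))
      exact ((h0 (χ n)).trans_lt one_lt_top).ne
    calc A + (wInt (p - 1) fun r => |deriv g r| ^ p) ≤ A + (1 - A) := by gcongr; exact hd.trans hl
      _ = 1 := add_tsub_cancel_of_le hA1
  · refine ENNReal.le_of_forall_pos_le_add fun ε hε _ => ?_
    obtain ⟨I, I₀, hI, hI₀, hb⟩ := exists_tendsto_lintegral_expTail hk hp hθ hσ hσμ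
      (fun n => h (χ n)) (fun n => h0 (χ n)) (fun n => h1 (χ n)) hgχ (ε := ε)
      (by exact_mod_cast hε)
    have hlim : Tendsto (fun n => ENNReal.ofReal (σ ^ k / (Nat.factorial k : ℝ)) *
        (wInt θ fun r => |f (χ n) r| ^ p) + (I n + ENNReal.ofReal ε)) atTop
        (𝓝 (ENNReal.ofReal (σ ^ k / (Nat.factorial k : ℝ)) * A + (I₀ + ENNReal.ofReal ε))) :=
      (ENNReal.Tendsto.const_mul hA (Or.inr ENNReal.ofReal_ne_top)).add
        (hI.add tendsto_const_nhds)
    have hMle := le_of_tendsto_of_tendsto' (hM.comp hχ.tendsto_atTop) hlim fun n => by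
      rw [Function.comp_apply, TMfunc_eq hk hp hσ.le (h (χ n)).aemeasurable]
      exact add_le_add le_rfl (hb n)
    refine hMle.trans ?_
    rw [← add_assoc, ENNReal.ofReal_coe_nnreal]
    gcongr

/-- If the supremum exceeds the vanishing level, then it is attained. -/
theorem TMCAttained_of_ofReal_lt {p θ σ : ℝ} {k : ℕ} (hk : (k : ℝ) = p - 1) (hp : 2 ≤ p)
    (hθ : 0 ≤ θ) (hσ : 0 < σ) (hσμ : σ < muC (p - 1) θ)
    (hlt : ENNReal.ofReal (σ ^ k / (Nat.factorial k : ℝ)) < TMC p (p - 1) θ σ) :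
    TMCAttained p (p - 1) θ σ := by
  have hp0 : 0 < p := by linarith
  set S : Set ℝ≥0∞ := {x | ∃ u u' : ℝ → ℝ, MemX p (p - 1) θ u u' ∧
    Xnorm p (p - 1) θ u u' ≤ 1 ∧ x = TMfunc p θ σ u} with hS
  have hTMC : TMC p (p - 1) θ σ = sSup S := by
    refine le_antisymm ?_ (sSup_le ?_)
    · exact iSup_le fun u => iSup_le fun u' => iSup_le fun hu => iSup_le fun hX =>
        le_sSup ⟨u, u', hu, hX, rfl⟩
    · rintro x ⟨u, u', hu, hX, rfl⟩
      exact TMfunc_le_TMC hp0 hu ((Xnorm_le_one_iff hp0 u u').1 hX)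
  have hSne : S.Nonempty := by
    by_contra hne
    rw [not_nonempty_iff_eq_empty.1 hne, _root_.sSup_empty] at hTMC
    rw [hTMC] at hlt
    exact not_lt_bot hlt
  obtain ⟨x, -, hx, hxS⟩ := exists_seq_tendsto_sSup hSne (OrderTop.bddAbove S)
  choose f f' hf hX hxf using hxS
  simp_rw [Xnorm_le_one_iff hp0] at hX
  rw [← hTMC] at hx
  obtain ⟨g, A, hg, hgA, hA1, hM⟩ := exists_limit_profile hk hp hθ hσ hσμ hf hX
    (hx.congr hxf)
  set c := ENNReal.ofReal (σ ^ k / (Nat.factorial k : ℝ)) with hc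
  set a := wInt θ fun r => |g r| ^ p with ha
  set G := ∫⁻ r, ENNReal.ofReal (expTail k (σ * |g r| ^ (p / (p - 1)))) ∂wMeas θ with hG
  have hA1' : A ≤ 1 := le_self_add.trans hA1
  have hAt : A ≠ ⊤ := (hA1'.trans_lt one_lt_top).ne
  have hat : a ≠ ⊤ := (hgA.trans_lt hAt.lt_top).ne
  have ha0 : a ≠ 0 := by
    intro h0
    have h1 := ae_eq_zero_of_wInt_eq_zero
      (hg.aemeasurable.mono_ac (wMeas_absolutelyContinuous θ)) h0
    have hq : p / (p - 1) ≠ 0 := (div_pos hp0 (by linarith)).ne'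
    have hG0 : G = 0 := by
      rw [hG, ← lintegral_zero (μ := wMeas θ)]
      refine lintegral_congr_ae (h1.mono fun r hr => ?_)
      have hz : expTail k 0 ≤ 0 := by simpa using expTail_le k le_rfl
      simpa [hr, Real.zero_rpow hq] using hz
    rw [hG0, add_zero] at hM
    refine absurd (hM.trans ?_) (not_le.2 hlt)
    simpa using mul_le_mul_right hA1' c
  have hapos : 0 < a.toReal := ENNReal.toReal_pos ha0 hat
  set t := A.toReal / a.toReal with ht
  have ht1 : 1 ≤ t := (one_le_div hapos).2 (ENNReal.toReal_mono hAt hgA)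
  have ht0 : 0 < t := by linarith
  have hta : ENNReal.ofReal t * a = A := by
    rw [← ENNReal.ofReal_toReal hat, ← ENNReal.ofReal_mul ht0.le, ht,
      div_mul_cancel₀ _ hapos.ne', ENNReal.ofReal_toReal hAt]
  set τ := t ^ (1 / (θ + 1)) with hτ
  have hτ0 : 0 < τ := by positivity
  have hτt : τ ^ (θ + 1) = t := by
    rw [hτ, ← Real.rpow_mul ht0.le, one_div_mul_cancel (by linarith), Real.rpow_one]
  have hv := hg.dilate hp0 one_pos hτ0
  have hvA : (wInt θ fun r => |1 * g (r / τ)| ^ p) = A := by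
    rw [wInt_dilate p θ g one_pos hτ0, Real.one_rpow, one_mul, hτt, ← ha, hta]
  have hvle : (wInt θ fun r => |1 * g (r / τ)| ^ p) +
      (wInt (p - 1) fun r => |1 / τ * deriv g (r / τ)| ^ p) ≤ 1 := by
    rw [hvA, wInt_dilate_deriv p (deriv g) one_pos hτ0, Real.one_rpow, ENNReal.ofReal_one, one_mul]
    exact hA1
  refine ⟨_, _, hv, (Xnorm_le_one_iff hp0 _ _).2 hvle, le_antisymm ?_ (TMfunc_le_TMC hp0 hv hvle)⟩
  have hTv : TMfunc p θ σ (fun r => 1 * g (r / τ)) = ENNReal.ofReal t * TMfunc p θ σ g := by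
    unfold TMfunc
    simp only [one_mul]
    rw [wInt_comp_div θ (fun r => phiP p (σ * |g r| ^ (p / (p - 1)))) hτ0, hτt]
  rw [hTv, TMfunc_eq hk hp hσ.le hg.aemeasurable, ← hc, ← ha, ← hG, mul_add, mul_left_comm, hta]
  refine hM.trans (add_le_add le_rfl ?_)
  have h1t : (1 : ℝ≥0∞) ≤ ENNReal.ofReal t := ENNReal.one_le_ofReal.2 ht1
  simpa using mul_le_mul_left h1t G

end

theorem stmt_9 (p α θ : ℝ) (hp : 2 ≤ p) (hα : α = p - 1) (hθ : 0 ≤ θ)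
    (hk : (k0 p : ℝ) = p - 1)
    (hne : {σ : ℝ | σ ∈ Set.Ioo 0 (muC α θ) ∧ TMCAttained p α θ σ}.Nonempty)
    (hlt : sigmaStar p α θ < muC α θ) :
    ∀ σ : ℝ, sigmaStar p α θ < σ → σ < muC α θ → TMCAttained p α θ σ := by
  intro σ hσ hσμ
  subst hα
  obtain ⟨σ₁, ⟨⟨hσ₁, -⟩, hatt⟩, hlt₁⟩ := exists_lt_of_csInf_lt hne hσ
  exact TMCAttained_of_ofReal_lt hk hp hθ (hσ₁.trans hlt₁) hσμ
    (ofReal_lt_TMC_of_attained hk hp hθ hσ₁ hlt₁ hatt)
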